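/- arXiv:2110.13147 — 3 statements merged into one kernel-verified Lean document; each statement's English description precedes it below -/
import Mathlib

section
/- Let α ∈ (0,1], T > 0, and let f : [0,T] × ℝ → ℝ be continuous, satisfy the Lipschitz condition, and satisfy f(t,0) = 0 for all t ∈ [0,T]. Let x₁, x₂ be solutions on [0,T] of the Caputo fractional initial value problems with initial values x₁₀, x₂₀ satisfying 0 < x₁₀ < x₂₀. Then for all t ∈ [0,T]: x₂₀·E_α(a_*(t) t^α) − x₁₀·E_α(a^*(t) t^α) ≤ x₂(t) − x₁(t) ≤ x₂₀·E_α(a^*(t) t^α) − x₁₀·E_α(a_*(t) t^α), where a_*(t) := inf_{s ∈ [0,t], x ≠ 0} f(s,x)/x and a^*(t) := sup_{s ∈ [0,t], x ≠ 0} f(s,x)/x. -/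
open Set intervalIntegral

/-- The one-parameter Mittag-Leffler function `E_α(x) = ∑_{k=0}^∞ x^k / Γ(αk+1)`. -/
noncomputable def mittagLeffler (α x : ℝ) : ℝ :=
  ∑' k : ℕ, x ^ k / Real.Gamma (α * (k : ℝ) + 1)

/-- A continuous function `x` on `[0,T]` solves the Caputo fractional initial value
problem `^C D^α_{0+} x(t) = f(t,x(t))`, `x(0) = x₀`, in the equivalent Volterra
integral formulation. -/
def IsCaputoSolution (α T : ℝ) (f : ℝ → ℝ → ℝ) (x₀ : ℝ) (x : ℝ → ℝ) : Prop :=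
  ContinuousOn x (Set.Icc 0 T) ∧
    ∀ t ∈ Set.Icc 0 T,
      x t = x₀ + (1 / Real.Gamma α) * ∫ s in (0:ℝ)..t, (t - s) ^ (α - 1) * f s (x s)

/-- `a_*(t) = inf_{s ∈ [0,t], x ≠ 0} f(s,x)/x`. -/
noncomputable def aLow (f : ℝ → ℝ → ℝ) (t : ℝ) : ℝ :=
  sInf {y | ∃ s ∈ Set.Icc 0 t, ∃ x : ℝ, x ≠ 0 ∧ y = f s x / x}

/-- `a^*(t) = sup_{s ∈ [0,t], x ≠ 0} f(s,x)/x`. -/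
noncomputable def aHigh (f : ℝ → ℝ → ℝ) (t : ℝ) : ℝ :=
  sSup {y | ∃ s ∈ Set.Icc 0 t, ∃ x : ℝ, x ≠ 0 ∧ y = f s x / x}

/-- The scaled real Beta integral `∫₀ᵃ x^(u-1) (a-x)^(v-1) dx = a^(u+v-1) B(u,v)`. -/
theorem integral_rpow_mul_sub_rpow {u v a : ℝ} (hu : 0 < u) (hv : 0 < v) (ha : 0 < a) :
    ∫ x in (0:ℝ)..a, x ^ (u - 1) * (a - x) ^ (v - 1) =
      a ^ (u + v - 1) * ProbabilityTheory.beta u v := by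
  have h := Complex.betaIntegral_scaled (u : ℂ) (v : ℂ) ha
  rw [Complex.betaIntegral_eq_Gamma_mul_div _ _ (by simpa using hu) (by simpa using hv)] at h
  rw [ProbabilityTheory.beta]
  apply Complex.ofReal_injective
  have e : ((∫ x in (0:ℝ)..a, x ^ (u - 1) * (a - x) ^ (v - 1) : ℝ) : ℂ) =
      ∫ x in (0:ℝ)..a, (x : ℂ) ^ ((u : ℂ) - 1) * ((a : ℂ) - x) ^ ((v : ℂ) - 1) := by
    rw [← intervalIntegral.integral_ofReal]
    refine intervalIntegral.integral_congr fun x hx => ?_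
    rw [Set.uIcc_of_le ha.le] at hx
    simp only [Complex.ofReal_mul]
    rw [Complex.ofReal_cpow hx.1, Complex.ofReal_cpow (sub_nonneg.2 hx.2)]
    push_cast
    rfl
  rw [e, h, ← Complex.ofReal_add, Complex.Gamma_ofReal, Complex.Gamma_ofReal,
    Complex.Gamma_ofReal]
  push_cast
  rw [Complex.ofReal_cpow ha.le]
  push_cast
  rfl

theorem intervalIntegrable_rpow_mul_sub_rpow {u v a : ℝ} (hu : 0 < u) (hv : 0 < v) (ha : 0 < a) :
    IntervalIntegrable (fun x : ℝ => x ^ (u - 1) * (a - x) ^ (v - 1)) MeasureTheory.volume 0 a := by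
  by_contra h
  have h0 := intervalIntegral.integral_undef h
  rw [integral_rpow_mul_sub_rpow hu hv ha] at h0
  exact (mul_pos (Real.rpow_pos_of_pos ha _) (ProbabilityTheory.beta_pos hu hv)).ne' h0

/-- Gamma quotient bound coming from log-convexity. -/
theorem Gamma_mul_rpow_le_Gamma_add {α x : ℝ} (hα : 0 < α) (hα1 : α ≤ 1) (hx : 0 ≤ x) :
    Real.Gamma (x + 1) * (x + α) ^ α ≤ Real.Gamma (x + α + 1) := by
  have hxa : 0 < x + α := by linarith
  rcases hα1.eq_or_lt with rfl | h1
  · rw [Real.rpow_one, Real.Gamma_add_one (s := x + 1) (by linarith), mul_comm]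
  · have h := Real.Gamma_mul_add_mul_le_rpow_Gamma_mul_rpow_Gamma (s := x + α) (t := x + α + 1)
      (a := α) (b := 1 - α) hxa (by linarith) hα (by linarith) (by ring)
    have hG : 0 < Real.Gamma (x + α) := Real.Gamma_pos_of_pos hxa
    rw [show α * (x + α) + (1 - α) * (x + α + 1) = x + 1 by ring] at h
    calc Real.Gamma (x + 1) * (x + α) ^ α
        ≤ Real.Gamma (x + α) ^ α * Real.Gamma (x + α + 1) ^ (1 - α) * (x + α) ^ α := by gcongr
      _ = ((x + α) * Real.Gamma (x + α)) ^ α * Real.Gamma (x + α + 1) ^ (1 - α) := by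
          rw [Real.mul_rpow hxa.le hG.le]; ring
      _ = Real.Gamma (x + α + 1) := by
          rw [← Real.Gamma_add_one hxa.ne', ← Real.rpow_add (Real.Gamma_pos_of_pos (by linarith))]
          simp

theorem summable_mittagLeffler {α : ℝ} (hα : 0 < α) (hα1 : α ≤ 1) (z : ℝ) :
    Summable fun k : ℕ => z ^ k / Real.Gamma (α * (k : ℝ) + 1) := by
  have hG : ∀ k : ℕ, 0 < Real.Gamma (α * (k : ℝ) + 1) := fun k =>
    Real.Gamma_pos_of_pos (by positivity)
  have hlim : Filter.Tendsto (fun k : ℕ => (α * (k : ℝ) + α) ^ α) Filter.atTop Filter.atTop :=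
    (tendsto_rpow_atTop hα).comp (Filter.tendsto_atTop_add_const_right _ _
      (tendsto_natCast_atTop_atTop.const_mul_atTop hα))
  refine summable_of_ratio_norm_eventually_le (r := 1 / 2) (by norm_num) ?_
  filter_upwards [hlim.eventually_ge_atTop (2 * |z|)] with k hk
  have h := Gamma_mul_rpow_le_Gamma_add (x := α * k) hα hα1 (by positivity)
  have e : α * ((k + 1 : ℕ) : ℝ) + 1 = α * k + α + 1 := by push_cast; ring
  rw [e, norm_div, norm_div, norm_pow, norm_pow, Real.norm_eq_abs, Real.norm_eq_abs,
    Real.norm_eq_abs, abs_of_pos (hG k), abs_of_pos (Real.Gamma_pos_of_pos (by positivity))]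
  rw [div_le_iff₀ (Real.Gamma_pos_of_pos (by positivity))]
  have hGk := hG k
  calc |z| ^ (k + 1) = 1 / 2 * (|z| ^ k / Real.Gamma (α * k + 1)) *
        (Real.Gamma (α * k + 1) * (2 * |z|)) := by field_simp; ring
    _ ≤ 1 / 2 * (|z| ^ k / Real.Gamma (α * k + 1)) *
        (Real.Gamma (α * k + 1) * (α * k + α) ^ α) := by gcongr
    _ ≤ _ := by gcongr

theorem continuous_mittagLeffler {α : ℝ} (hα : 0 < α) (hα1 : α ≤ 1) :
    Continuous (mittagLeffler α) := by
  rw [continuous_iff_continuousAt]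
  intro z
  have hc : ContinuousOn (mittagLeffler α) (Set.Ioo (-(|z| + 1)) (|z| + 1)) := by
    refine continuousOn_tsum (fun k => by fun_prop) (summable_mittagLeffler hα hα1 (|z| + 1)) ?_
    intro k w hw
    have hG : 0 < Real.Gamma (α * (k : ℝ) + 1) := Real.Gamma_pos_of_pos (by positivity)
    rw [norm_div, norm_pow, Real.norm_eq_abs, Real.norm_eq_abs, abs_of_pos hG]
    have := abs_lt.2 hw
    gcongr
  exact hc.continuousAt (Ioo_mem_nhds (by linarith [neg_abs_le z]) (by linarith [le_abs_self z]))

theorem mittagLeffler_zero (α : ℝ) : mittagLeffler α 0 = 1 := by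
  rw [mittagLeffler, tsum_eq_single 0 (fun k hk => by simp [hk])]
  simp

/-- `t ↦ E_α(c t^α)` solves the linear fractional Volterra equation with coefficient `c`. -/
theorem mittagLeffler_volterra {α : ℝ} (hα : 0 < α) (hα1 : α ≤ 1) (c : ℝ) {t : ℝ} (ht : 0 ≤ t) :
    mittagLeffler α (c * t ^ α) = 1 + (1 / Real.Gamma α) *
      ∫ s in (0:ℝ)..t, (t - s) ^ (α - 1) * (c * mittagLeffler α (c * s ^ α)) := by
  rcases ht.eq_or_lt with rfl | ht
  · simp [Real.zero_rpow hα.ne', mittagLeffler_zero]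
  have hGα := Real.Gamma_pos_of_pos hα
  have hG : ∀ k : ℕ, 0 < Real.Gamma (α * (k : ℝ) + 1) := fun k =>
    Real.Gamma_pos_of_pos (by positivity)
  set F : ℝ → ℕ → ℝ → ℝ := fun d k s =>
    (d ^ (k + 1) / Real.Gamma (α * k + 1)) * (s ^ ((α * k + 1) - 1) * (t - s) ^ (α - 1)) with hF
  have hFint : ∀ d k, IntervalIntegrable (F d k) MeasureTheory.volume 0 t := fun d k =>
    (intervalIntegrable_rpow_mul_sub_rpow (by positivity) hα ht).const_mul _
  have hFval : ∀ d k, ∫ s in (0:ℝ)..t, F d k s =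
      Real.Gamma α * ((d * t ^ α) ^ (k + 1) / Real.Gamma (α * ((k + 1 : ℕ) : ℝ) + 1)) := by
    intro d k
    rw [hF]
    simp only
    rw [intervalIntegral.integral_const_mul,
      integral_rpow_mul_sub_rpow (by positivity) hα ht, ProbabilityTheory.beta]
    have e1 : α * (k : ℝ) + 1 + α = α * ((k + 1 : ℕ) : ℝ) + 1 := by push_cast; ring
    have e2 : t ^ (α * (k : ℝ) + 1 + α - 1) = (t ^ α) ^ (k + 1) := by
      rw [← Real.rpow_natCast, ← Real.rpow_mul ht.le]; congr 1; push_cast; ring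
    rw [e2, e1, mul_pow]
    have := (hG k).ne'
    have := (hG (k + 1)).ne'
    field_simp
  have hnorm : ∀ k, ∫ s in Set.Ioc 0 t, ‖F c k s‖ = ∫ s in (0:ℝ)..t, F |c| k s := by
    intro k
    rw [intervalIntegral.integral_of_le ht.le]
    refine MeasureTheory.setIntegral_congr_fun measurableSet_Ioc fun s hs => ?_
    have h1 : 0 ≤ s ^ ((α * (k : ℝ) + 1) - 1) * (t - s) ^ (α - 1) :=
      mul_nonneg (Real.rpow_nonneg hs.1.le _) (Real.rpow_nonneg (sub_nonneg.2 hs.2) _)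
    simp only [hF, Real.norm_eq_abs]
    rw [abs_mul, abs_of_nonneg h1, abs_div, abs_pow, abs_of_pos (hG k)]
  have hs : HasSum (fun k => ∫ s in Set.Ioc 0 t, F c k s)
      (∫ s in Set.Ioc 0 t, ∑' k, F c k s) := by
    refine MeasureTheory.hasSum_integral_of_summable_integral_norm
      (fun k => (intervalIntegrable_iff_integrableOn_Ioc_of_le ht.le).1 (hFint c k)) ?_
    simp_rw [hnorm, hFval]
    exact ((summable_nat_add_iff 1).2 (summable_mittagLeffler hα hα1 (|c| * t ^ α))).mul_left _
  have hsum : ∫ s in Set.Ioc 0 t, ∑' k, F c k s =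
      ∫ s in (0:ℝ)..t, (t - s) ^ (α - 1) * (c * mittagLeffler α (c * s ^ α)) := by
    rw [intervalIntegral.integral_of_le ht.le]
    refine MeasureTheory.setIntegral_congr_fun measurableSet_Ioc fun s hs => ?_
    simp only [mittagLeffler]
    rw [← tsum_mul_left, ← tsum_mul_left]
    refine tsum_congr fun k => ?_
    simp only [hF]
    rw [add_sub_cancel_right, mul_pow, ← Real.rpow_natCast (s ^ α), ← Real.rpow_mul hs.1.le]
    ring
  rw [← hsum, ← hs.tsum_eq, mittagLeffler,
    (summable_mittagLeffler hα hα1 (c * t ^ α)).tsum_eq_zero_add]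
  simp_rw [← intervalIntegral.integral_of_le ht.le, hFval]
  rw [tsum_mul_left, ← mul_assoc, one_div, inv_mul_cancel₀ hGα.ne', one_mul]
  simp

/-- A Möbius-transformed Beta integral: the Riemann–Liouville kernel `(t-s)^(α-1)` is, up to a
positive factor, an average over `r ∈ (s, τ)` of the kernels `(r-s)^(α-1)`. -/
theorem integral_balayage_kernel {α s τ t : ℝ} (hα : 0 < α) (hα1 : α < 1) (hs : s < τ)
    (ht : τ < t) :
    ∫ r in Set.Ioo s τ, (τ - r) ^ (-α) / (t - r) * (r - s) ^ (α - 1) =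
      ProbabilityTheory.beta α (1 - α) * (t - τ) ^ (-α) * (t - s) ^ (α - 1) := by
  have hτs : 0 < τ - s := sub_pos.2 hs
  have htτ : 0 < t - τ := sub_pos.2 ht
  have hts : 0 < t - s := by linarith
  set w : ℝ → ℝ := fun r => (r - s) * (t - τ) / ((τ - s) * (t - r)) with hw
  set w' : ℝ → ℝ := fun r => (t - τ) * (t - s) / ((τ - s) * (t - r) ^ 2) with hw'
  have hd : ∀ r ∈ Set.Ioo s τ, HasDerivWithinAt w (w' r) (Set.Ioo s τ) r := by
    intro r hr
    have htr : t - r ≠ 0 := by linarith [hr.2]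
    have h := (((hasDerivAt_id r).sub_const s).mul_const (t - τ)).div
      (((hasDerivAt_id r).const_sub t).const_mul (τ - s)) (mul_ne_zero hτs.ne' htr)
    refine (h.congr_deriv ?_).hasDerivWithinAt
    simp only [hw', id]
    field_simp
    ring
  have hone : ∀ r ∈ Set.Ioo s τ, 1 - w r = (τ - r) * (t - s) / ((τ - s) * (t - r)) := by
    intro r hr
    have htr : t - r ≠ 0 := by linarith [hr.2]
    simp only [hw]
    field_simp
    ring
  have hinj : Set.InjOn w (Set.Ioo s τ) := by
    intro a ha b hb hab
    have hta : t - a ≠ 0 := by linarith [ha.2]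
    have htb : t - b ≠ 0 := by linarith [hb.2]
    simp only [hw] at hab
    rw [div_eq_div_iff (mul_ne_zero hτs.ne' hta) (mul_ne_zero hτs.ne' htb)] at hab
    have : (a - b) * ((τ - s) * (t - τ) * (t - s)) = 0 := by linear_combination hab
    rcases mul_eq_zero.1 this with h | h
    · linarith
    · exact absurd h (by positivity)
  have himg : w '' Set.Ioo s τ = Set.Ioo 0 1 := by
    ext y
    constructor
    · rintro ⟨r, hr, rfl⟩
      have h1 : 0 < r - s := sub_pos.2 hr.1
      have h2 : 0 < τ - r := sub_pos.2 hr.2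
      have h3 : 0 < t - r := by linarith
      refine ⟨by simp only [hw]; positivity, ?_⟩
      have := hone r hr
      have h4 : 0 < (τ - r) * (t - s) / ((τ - s) * (t - r)) := by positivity
      linarith
    · rintro ⟨hy0, hy1⟩
      have hD : 0 < (t - τ) + y * (τ - s) := by positivity
      refine ⟨s + y * (τ - s) * (t - s) / ((t - τ) + y * (τ - s)), ⟨?_, ?_⟩, ?_⟩
      · have : 0 < y * (τ - s) * (t - s) / ((t - τ) + y * (τ - s)) := by positivity
        linarith
      · have : y * (τ - s) * (t - s) / ((t - τ) + y * (τ - s)) < τ - s := by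
          rw [div_lt_iff₀ hD]
          have : 0 < (τ - s) * (t - τ) * (1 - y) := by
            have := sub_pos.2 hy1
            positivity
          linarith
        linarith
      · have e : t - (s + y * (τ - s) * (t - s) / ((t - τ) + y * (τ - s))) =
            (t - s) * (t - τ) / ((t - τ) + y * (τ - s)) := by
          field_simp
          ring
        simp only [hw]
        rw [e, add_sub_cancel_left]
        field_simp
  have hcv := MeasureTheory.integral_image_eq_integral_abs_deriv_smul measurableSet_Ioo hd hinj
    (fun y : ℝ => y ^ (α - 1) * (1 - y) ^ ((1 - α) - 1))
  have hbeta := integral_rpow_mul_sub_rpow hα (sub_pos.2 hα1) one_pos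
  rw [intervalIntegral.integral_of_le zero_le_one,
    MeasureTheory.integral_Ioc_eq_integral_Ioo, ← himg, hcv, Real.one_rpow, one_mul] at hbeta
  rw [← hbeta, mul_assoc, ← MeasureTheory.integral_mul_const]
  refine MeasureTheory.setIntegral_congr_fun measurableSet_Ioo fun r hr => ?_
  have h1 : 0 < r - s := sub_pos.2 hr.1
  have h2 : 0 < τ - r := sub_pos.2 hr.2
  have h3 : 0 < t - r := by linarith
  have hwpos : 0 < w' r := by simp only [hw']; positivity
  simp only [smul_eq_mul]
  rw [abs_of_pos hwpos, hone r hr]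
  simp only [hw, hw']
  rw [Real.div_rpow (by positivity) (by positivity), Real.div_rpow (by positivity) (by positivity),
    Real.mul_rpow h1.le htτ.le, Real.mul_rpow hτs.le h3.le, Real.mul_rpow h2.le hts.le,
    Real.mul_rpow hτs.le h3.le, show (1 - α) - 1 = -α by ring,
    Real.rpow_sub_one h1.ne', Real.rpow_sub_one htτ.ne', Real.rpow_sub_one hτs.ne',
    Real.rpow_sub_one h3.ne', Real.rpow_sub_one hts.ne', Real.rpow_neg h2.le, Real.rpow_neg hts.le,
    Real.rpow_neg hτs.le, Real.rpow_neg h3.le, Real.rpow_neg htτ.le]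
  have := Real.rpow_pos_of_pos h1 α
  have := Real.rpow_pos_of_pos h2 α
  have := Real.rpow_pos_of_pos h3 α
  have := Real.rpow_pos_of_pos hτs α
  have := Real.rpow_pos_of_pos htτ α
  have := Real.rpow_pos_of_pos hts α
  field_simp

theorem integrableOn_balayage_kernel {α s τ t : ℝ} (hα : 0 < α) (hα1 : α < 1) (hs : s < τ)
    (ht : τ < t) :
    MeasureTheory.IntegrableOn (fun r => (τ - r) ^ (-α) / (t - r) * (r - s) ^ (α - 1))
      (Set.Ioo s τ) := by
  by_contra h
  have h0 := MeasureTheory.integral_undef h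
  rw [integral_balayage_kernel hα hα1 hs ht] at h0
  exact (mul_pos (mul_pos (ProbabilityTheory.beta_pos hα (sub_pos.2 hα1))
    (Real.rpow_pos_of_pos (sub_pos.2 ht) _)) (Real.rpow_pos_of_pos (by linarith) _)).ne' h0

/-- If the fractional integral of `H` is nonnegative on `(0, τ)`, then the part of the fractional
integral at a later time `t` that comes from `(0, τ)` is nonnegative as well. -/
theorem fractionalIntegral_memory_nonneg {α τ t : ℝ} (hα : 0 < α) (hα1 : α < 1)
    (ht : τ < t) {H : ℝ → ℝ} (hH : MeasureTheory.IntegrableOn H (Set.Ioo 0 τ))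
    (hpos : ∀ r ∈ Set.Ioo 0 τ, 0 ≤ ∫ s in Set.Ioo 0 r, (r - s) ^ (α - 1) * H s) :
    0 ≤ ∫ s in Set.Ioo 0 τ, (t - s) ^ (α - 1) * H s := by
  set μ := MeasureTheory.volume.restrict (Set.Ioo (0:ℝ) τ) with hμ
  set q : ℝ → ℝ := fun r => (τ - r) ^ (-α) / (t - r) with hq
  set C : ℝ := ProbabilityTheory.beta α (1 - α) * (t - τ) ^ (-α) with hC
  have hCpos : 0 < C := mul_pos (ProbabilityTheory.beta_pos hα (sub_pos.2 hα1))
    (Real.rpow_pos_of_pos (sub_pos.2 ht) _)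
  set K : ℝ × ℝ → ℝ := {p : ℝ × ℝ | p.2 < p.1}.indicator
    (fun p => q p.1 * (p.1 - p.2) ^ (α - 1)) with hK
  have hKm : Measurable K := by
    refine Measurable.indicator ?_ (measurableSet_lt measurable_snd measurable_fst)
    simp only [hq]
    fun_prop
  have hKr : ∀ s, (fun r => K (r, s)) =
      (Set.Ioi s).indicator (fun r => q r * (r - s) ^ (α - 1)) := by
    intro s
    ext r
    simp [hK, Set.indicator]
  have hinter : ∀ s ∈ Set.Ioo 0 τ, Set.Ioo 0 τ ∩ Set.Ioi s = Set.Ioo s τ := by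
    intro s hs
    ext r
    simp only [Set.mem_inter_iff, Set.mem_Ioo, Set.mem_Ioi]
    constructor
    · rintro ⟨⟨-, h2⟩, h3⟩
      exact ⟨h3, h2⟩
    · rintro ⟨h1, h2⟩
      exact ⟨⟨hs.1.trans h1, h2⟩, h1⟩
  have hKint : ∀ s ∈ Set.Ioo 0 τ, ∫ r, K (r, s) ∂μ = C * (t - s) ^ (α - 1) := by
    intro s hs
    rw [hKr, hμ, MeasureTheory.setIntegral_indicator measurableSet_Ioi, hinter s hs]
    exact integral_balayage_kernel hα hα1 hs.2 ht
  have hKi : ∀ s ∈ Set.Ioo 0 τ, MeasureTheory.Integrable (fun r => K (r, s)) μ := by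
    intro s hs
    rw [hKr, MeasureTheory.integrable_indicator_iff measurableSet_Ioi, hμ,
      MeasureTheory.IntegrableOn, MeasureTheory.Measure.restrict_restrict measurableSet_Ioi,
      Set.inter_comm, hinter s hs]
    exact integrableOn_balayage_kernel hα hα1 hs.2 ht
  have hq0 : ∀ r ∈ Set.Ioo 0 τ, 0 ≤ q r := fun r hr =>
    div_nonneg (Real.rpow_nonneg (sub_nonneg.2 hr.2.le) _) (by linarith [hr.2])
  have hK0 : ∀ r ∈ Set.Ioo 0 τ, ∀ s, 0 ≤ K (r, s) := by
    intro r hr s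
    simp only [hK]
    refine Set.indicator_apply_nonneg fun hp => ?_
    exact mul_nonneg (hq0 r hr) (Real.rpow_nonneg (sub_nonneg.2 (le_of_lt hp)) _)
  have hkH : MeasureTheory.Integrable (fun s => C * ((t - s) ^ (α - 1) * ‖H s‖)) μ := by
    refine MeasureTheory.Integrable.const_mul ?_ _
    refine hH.norm.bdd_mul (c := (t - τ) ^ (α - 1))
      (Measurable.aestronglyMeasurable (by fun_prop)) ?_
    filter_upwards [MeasureTheory.ae_restrict_mem measurableSet_Ioo] with s hs
    rw [Real.norm_eq_abs, abs_of_nonneg (Real.rpow_nonneg (by linarith [hs.2]) _)]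
    exact Real.rpow_le_rpow_of_nonpos (by linarith) (by linarith [hs.2]) (by linarith)
  have hF : MeasureTheory.Integrable (Function.uncurry fun r s => K (r, s) * H s) (μ.prod μ) := by
    refine (MeasureTheory.integrable_prod_iff' ?_).2 ⟨?_, ?_⟩
    · exact hKm.aestronglyMeasurable.mul hH.aestronglyMeasurable.comp_snd
    · filter_upwards [MeasureTheory.ae_restrict_mem measurableSet_Ioo] with s hs
      exact (hKi s hs).mul_const (H s)
    · refine hkH.congr ?_
      filter_upwards [MeasureTheory.ae_restrict_mem measurableSet_Ioo] with s hs
      have : ∫ r, ‖K (r, s) * H s‖ ∂μ = ∫ r, K (r, s) * ‖H s‖ ∂μ := by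
        refine MeasureTheory.setIntegral_congr_fun measurableSet_Ioo fun r hr => ?_
        simp only [norm_mul]
        rw [Real.norm_of_nonneg (hK0 r hr s)]
      simp only [Function.uncurry]
      rw [this, MeasureTheory.integral_mul_const, hKint s hs, ← mul_assoc]
  have hswap := MeasureTheory.integral_integral_swap hF
  have hR : ∫ s, ∫ r, K (r, s) * H s ∂μ ∂μ = C * ∫ s, (t - s) ^ (α - 1) * H s ∂μ := by
    rw [← MeasureTheory.integral_const_mul]
    refine MeasureTheory.setIntegral_congr_fun measurableSet_Ioo fun s hs => ?_
    rw [MeasureTheory.integral_mul_const, hKint s hs, mul_assoc]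
  have hL : 0 ≤ ∫ r, ∫ s, K (r, s) * H s ∂μ ∂μ := by
    refine MeasureTheory.setIntegral_nonneg measurableSet_Ioo fun r hr => ?_
    have e : (fun s => K (r, s) * H s) =
        (Set.Iio r).indicator (fun s => q r * ((r - s) ^ (α - 1) * H s)) := by
      ext s
      by_cases h : s < r <;> simp [hK, h, mul_assoc]
    have e2 : Set.Ioo 0 τ ∩ Set.Iio r = Set.Ioo 0 r := by
      ext s
      simp only [Set.mem_inter_iff, Set.mem_Ioo, Set.mem_Iio]
      exact ⟨fun h => ⟨h.1.1, h.2⟩, fun h => ⟨⟨h.1, h.2.trans hr.2⟩, h.2⟩⟩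
    rw [e, hμ, MeasureTheory.setIntegral_indicator measurableSet_Iio, e2,
      MeasureTheory.integral_const_mul]
    exact mul_nonneg (hq0 r hr) (hpos r hr)
  rw [hswap, hR] at hL
  exact nonneg_of_mul_nonneg_right hL hCpos

theorem intervalIntegrable_fractional_kernel_mul {α r : ℝ} (hα : 0 < α) (hr : 0 ≤ r) {h : ℝ → ℝ}
    (hh : ContinuousOn h (Set.Icc 0 r)) :
    IntervalIntegrable (fun s => (r - s) ^ (α - 1) * h s) MeasureTheory.volume 0 r := by
  rcases hr.eq_or_lt with rfl | hr
  · simp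
  · have hk := intervalIntegrable_rpow_mul_sub_rpow one_pos hα hr
    simp only [sub_self, Real.rpow_zero, one_mul] at hk
    exact hk.mul_continuousOn (by rwa [Set.uIcc_of_le hr.le])

/-- At its first zero, the solution of a fractional inequality would have to be positive:
the case `α < 1`. -/
theorem fractional_first_zero_absurd {α c M t : ℝ} (hα : 0 < α) (hα1 : α < 1) (hc : 0 < c)
    (ht : 0 < t) {v h : ℝ → ℝ} (hv : ContinuousOn v (Set.Icc 0 t))
    (hh : ContinuousOn h (Set.Icc 0 t))
    (hvol : ∀ r ∈ Set.Icc 0 t,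
      v r = c + (1 / Real.Gamma α) * ∫ s in (0:ℝ)..r, (r - s) ^ (α - 1) * h s)
    (hle : ∀ r ∈ Set.Icc 0 t, -(M * |v r|) ≤ h r)
    (hpos : ∀ r ∈ Set.Ico 0 t, 0 < v r) (hzero : v t = 0) : False := by
  have hG := Real.Gamma_pos_of_pos hα
  have hB := ProbabilityTheory.beta_pos (sub_pos.2 hα1) hα
  set d : ℝ := c * Real.Gamma α / ProbabilityTheory.beta (1 - α) α with hd
  have hdpos : 0 < d := by positivity
  set H : ℝ → ℝ := fun s => h s + d * s ^ (-α) with hH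
  have hint : ∀ r ∈ Set.Ioc 0 t,
      IntervalIntegrable (fun s => (r - s) ^ (α - 1) * H s) MeasureTheory.volume 0 r ∧
        ∫ s in (0:ℝ)..r, (r - s) ^ (α - 1) * H s = Real.Gamma α * v r := by
    intro r hr
    have i1 := intervalIntegrable_fractional_kernel_mul hα hr.1.le
      (hh.mono (Set.Icc_subset_Icc_right hr.2))
    have i2 := (intervalIntegrable_rpow_mul_sub_rpow (sub_pos.2 hα1) hα hr.1).const_mul d
    have e2 := integral_rpow_mul_sub_rpow (sub_pos.2 hα1) hα hr.1
    have e : (fun s => (r - s) ^ (α - 1) * H s) = fun s => (r - s) ^ (α - 1) * h s +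
        d * (s ^ ((1 - α) - 1) * (r - s) ^ (α - 1)) := by
      ext s
      simp only [hH]
      rw [show (1 - α) - 1 = -α by ring]
      ring
    rw [e]
    refine ⟨i1.add i2, ?_⟩
    rw [intervalIntegral.integral_add i1 i2, intervalIntegral.integral_const_mul, e2,
      hvol r ⟨hr.1.le, hr.2⟩, show 1 - α + α - 1 = 0 by ring, Real.rpow_zero, one_mul, hd]
    field_simp
    ring
  have hev : ∀ᶠ s in nhdsWithin t (Set.Iio t), M * |v s| < d * t ^ (-α) := by
    have hct : Filter.Tendsto (fun s => M * |v s|) (nhdsWithin t (Set.Icc 0 t))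
        (nhds (M * |v t|)) := ((hv t ⟨ht.le, le_rfl⟩).abs).const_mul M
    rw [hzero, abs_zero, mul_zero] at hct
    have h1 := hct.eventually_lt_const (mul_pos hdpos (Real.rpow_pos_of_pos ht (-α)))
    rw [← nhdsWithin_Ioo_eq_nhdsLT ht]
    exact nhdsWithin_mono t Set.Ioo_subset_Icc_self h1
  obtain ⟨l, hl, hlsub⟩ := (mem_nhdsLT_iff_exists_mem_Ico_Ioo_subset ht).1 hev
  set τ : ℝ := (l + t) / 2 with hτ
  have hτ0 : 0 < τ := by linarith [hl.1]
  have hτt : τ < t := by linarith [hl.2]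
  have hlτ : l < τ := by linarith [hl.2]
  obtain ⟨it, et⟩ := hint t ⟨ht, le_rfl⟩
  have ia := it.mono_set (c := 0) (d := τ) (by
    rw [Set.uIcc_of_le hτ0.le, Set.uIcc_of_le ht.le]; exact Set.Icc_subset_Icc_right hτt.le)
  have ib := it.mono_set (c := τ) (d := t) (by
    rw [Set.uIcc_of_le hτt.le, Set.uIcc_of_le ht.le]; exact Set.Icc_subset_Icc_left hτ0.le)
  have hHint : MeasureTheory.IntegrableOn H (Set.Ioo 0 τ) := by
    have j1 : MeasureTheory.IntegrableOn h (Set.Ioo 0 τ) :=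
      ((hh.mono (Set.Icc_subset_Icc_right hτt.le)).integrableOn_Icc).mono_set
        Set.Ioo_subset_Icc_self
    have j2 : MeasureTheory.IntegrableOn (fun s : ℝ => s ^ (-α)) (Set.Ioo 0 τ) :=
      (intervalIntegral.integrableOn_Ioo_rpow_iff hτ0).2 (by linarith)
    exact j1.add (j2.const_mul d)
  have hfirst : 0 ≤ ∫ s in (0:ℝ)..τ, (t - s) ^ (α - 1) * H s := by
    rw [intervalIntegral.integral_of_le hτ0.le, MeasureTheory.integral_Ioc_eq_integral_Ioo]
    refine fractionalIntegral_memory_nonneg hα hα1 hτt hHint fun r hr => ?_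
    have hrt : r < t := hr.2.trans hτt
    rw [← MeasureTheory.integral_Ioc_eq_integral_Ioo, ← intervalIntegral.integral_of_le hr.1.le,
      (hint r ⟨hr.1, hrt.le⟩).2]
    exact (mul_pos hG (hpos r ⟨hr.1.le, hrt⟩)).le
  have hsecond : 0 < ∫ s in τ..t, (t - s) ^ (α - 1) * H s := by
    refine intervalIntegral.intervalIntegral_pos_of_pos_on ib (fun s hs => ?_) hτt
    have hs0 : 0 < s := hτ0.trans hs.1
    refine mul_pos (Real.rpow_pos_of_pos (sub_pos.2 hs.2) _) ?_
    have h1 : M * |v s| < d * t ^ (-α) := hlsub ⟨hlτ.trans hs.1, hs.2⟩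
    have h2 := hle s ⟨hs0.le, hs.2.le⟩
    have h3 : d * t ^ (-α) ≤ d * s ^ (-α) :=
      mul_le_mul_of_nonneg_left
        (Real.rpow_le_rpow_of_nonpos hs0 hs.2.le (by linarith)) hdpos.le
    simp only [hH]
    linarith
  have hadd := intervalIntegral.integral_add_adjacent_intervals ia ib
  rw [et, hzero, mul_zero] at hadd
  linarith

/-- At its first zero, the solution of a differential inequality would have to be positive:
the classical case `α = 1`. -/
theorem integral_first_zero_absurd {c M t : ℝ} (hM : 0 ≤ M) (ht : 0 < t) {v h : ℝ → ℝ}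
    (hv : ContinuousOn v (Set.Icc 0 t)) (hh : ContinuousOn h (Set.Icc 0 t))
    (hvol : ∀ r ∈ Set.Icc 0 t, v r = c + ∫ s in (0:ℝ)..r, h s)
    (hle : ∀ r ∈ Set.Icc 0 t, -(M * |v r|) ≤ h r)
    (hpos : ∀ r ∈ Set.Ico 0 t, 0 < v r) (hzero : v t = 0) : False := by
  set τ : ℝ := max 0 (t - 1 / (2 * (M + 1))) with hτ
  have hτ0 : 0 ≤ τ := le_max_left _ _
  have hτt : τ < t := max_lt ht (by
    have : 0 < 1 / (2 * (M + 1)) := by positivity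
    linarith)
  have hsub : Set.Icc τ t ⊆ Set.Icc 0 t := Set.Icc_subset_Icc_left hτ0
  obtain ⟨m, hm, hmax⟩ := isCompact_Icc.exists_isMaxOn ⟨τ, le_rfl, hτt.le⟩ (hv.mono hsub)
  have hvm : 0 < v m := (hpos τ ⟨hτ0, hτt⟩).trans_le (hmax ⟨le_rfl, hτt.le⟩)
  have hmt : m < t := by
    refine lt_of_le_of_ne hm.2 fun e => ?_
    rw [e, hzero] at hvm
    exact lt_irrefl _ hvm
  have hm0 : 0 ≤ m := hτ0.trans hm.1
  have i1 : IntervalIntegrable h MeasureTheory.volume 0 m :=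
    (hh.mono (Set.Icc_subset_Icc_right hm.2)).intervalIntegrable_of_Icc hm0
  have i2 : IntervalIntegrable h MeasureTheory.volume m t :=
    (hh.mono (Set.Icc_subset_Icc_left hm0)).intervalIntegrable_of_Icc hm.2
  have hadd := intervalIntegral.integral_add_adjacent_intervals i1 i2
  have e1 := hvol m ⟨hm0, hm.2⟩
  have e2 := hvol t ⟨ht.le, le_rfl⟩
  have hlow : ∫ _ in m..t, -(M * v m) ≤ ∫ s in m..t, h s := by
    refine intervalIntegral.integral_mono_on hm.2 (by simp) i2 fun s hs => ?_
    have hs0 : 0 ≤ s := hm0.trans hs.1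
    refine le_trans (neg_le_neg (mul_le_mul_of_nonneg_left ?_ hM)) (hle s ⟨hs0, hs.2⟩)
    have hvs : 0 ≤ v s := by
      rcases hs.2.eq_or_lt with e | hlt
      · rw [e, hzero]
      · exact (hpos s ⟨hs0, hlt⟩).le
    rw [abs_of_nonneg hvs]
    exact hmax ⟨hm.1.trans hs.1, hs.2⟩
  rw [intervalIntegral.integral_const, smul_eq_mul] at hlow
  have hlen : t - m ≤ 1 / (2 * (M + 1)) := by
    have := (le_max_right 0 (t - 1 / (2 * (M + 1)))).trans hm.1
    linarith
  have hsmall : (t - m) * (M + 1) ≤ 1 / 2 := by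
    calc (t - m) * (M + 1) ≤ 1 / (2 * (M + 1)) * (M + 1) := by gcongr
      _ = 1 / 2 := by field_simp
  have : (t - m) * M ≤ 1 / 2 := by nlinarith
  have : (t - m) * M * v m ≤ 1 / 2 * v m := by gcongr
  linarith

/-- Positivity principle for fractional Volterra inequalities of order `α ∈ (0, 1]`. -/
theorem fractional_volterra_pos {α c M T : ℝ} (hα : 0 < α) (hα1 : α ≤ 1) (hc : 0 < c)
    (hM : 0 ≤ M) {v h : ℝ → ℝ} (hv : ContinuousOn v (Set.Icc 0 T))
    (hh : ContinuousOn h (Set.Icc 0 T))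
    (hvol : ∀ r ∈ Set.Icc 0 T,
      v r = c + (1 / Real.Gamma α) * ∫ s in (0:ℝ)..r, (r - s) ^ (α - 1) * h s)
    (hle : ∀ r ∈ Set.Icc 0 T, -(M * |v r|) ≤ h r) :
    ∀ t ∈ Set.Icc 0 T, 0 < v t := by
  by_contra! hcon
  obtain ⟨t₀, ht₀, hvt₀⟩ := hcon
  have hv0 : v 0 = c := by simpa using hvol 0 ⟨le_rfl, ht₀.1.trans ht₀.2⟩
  have hcross : ∀ r ∈ Set.Icc 0 T, v r ≤ 0 → ∃ s ∈ Set.Icc 0 r, v s = 0 := by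
    intro r hr hvr
    exact intermediate_value_Icc' hr.1 (hv.mono (Set.Icc_subset_Icc_right hr.2))
      ⟨hvr, hv0 ▸ hc.le⟩
  have hcomp : IsCompact (Set.Icc 0 T ∩ v ⁻¹' {0}) :=
    isCompact_Icc.of_isClosed_subset (hv.preimage_isClosed_of_isClosed isClosed_Icc
      isClosed_singleton) Set.inter_subset_left
  have hne : (Set.Icc 0 T ∩ v ⁻¹' {0}).Nonempty := by
    obtain ⟨s, hs, hvs⟩ := hcross t₀ ht₀ hvt₀
    exact ⟨s, ⟨hs.1, hs.2.trans ht₀.2⟩, hvs⟩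
  obtain ⟨t, ⟨ht, hvt⟩, hmin⟩ := hcomp.exists_isLeast hne
  have hzero : v t = 0 := hvt
  have htpos : 0 < t := by
    refine lt_of_le_of_ne ht.1 fun e => ?_
    rw [← e, hv0] at hzero
    exact hc.ne' hzero
  have hsub : Set.Icc 0 t ⊆ Set.Icc 0 T := Set.Icc_subset_Icc_right ht.2
  have hpos : ∀ r ∈ Set.Ico 0 t, 0 < v r := by
    intro r hr
    by_contra! hvr
    have hrT : r ∈ Set.Icc 0 T := ⟨hr.1, hr.2.le.trans ht.2⟩
    obtain ⟨s, hs, hvs⟩ := hcross r hrT hvr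
    have := hmin ⟨⟨hs.1, hs.2.trans hrT.2⟩, hvs⟩
    linarith [hs.2, hr.2]
  rcases hα1.eq_or_lt with rfl | hlt
  · refine integral_first_zero_absurd (c := c) hM htpos (hv.mono hsub) (hh.mono hsub)
      (fun r hr => ?_) (fun r hr => hle r (hsub hr)) hpos hzero
    simpa using hvol r (hsub hr)
  · exact fractional_first_zero_absurd hα hlt hc htpos (hv.mono hsub) (hh.mono hsub)
      (fun r hr => hvol r (hsub hr)) (fun r hr => hle r (hsub hr)) hpos hzero

/-- Comparison of a fractional supersolution with the Mittag-Leffler solution of the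
linear equation. -/
theorem mul_mittagLeffler_le_of_supersolution {α t x₀ a : ℝ} (hα : 0 < α) (hα1 : α ≤ 1)
    (ht : 0 ≤ t) {x g : ℝ → ℝ} (hx : ContinuousOn x (Set.Icc 0 t))
    (hg : ContinuousOn g (Set.Icc 0 t))
    (hvol : ∀ r ∈ Set.Icc 0 t,
      x r = x₀ + (1 / Real.Gamma α) * ∫ s in (0:ℝ)..r, (r - s) ^ (α - 1) * g s)
    (hle : ∀ r ∈ Set.Icc 0 t, a * x r ≤ g r) :
    x₀ * mittagLeffler α (a * t ^ α) ≤ x t := by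
  set y : ℝ → ℝ := fun s => mittagLeffler α (a * s ^ α) with hy
  have hyc : Continuous y :=
    (continuous_mittagLeffler hα hα1).comp ((Real.continuous_rpow_const hα.le).const_mul a)
  have key : ∀ ε > 0, (x₀ - ε) * y t ≤ x t := by
    intro ε hε
    have hpos := fractional_volterra_pos (M := |a|) (v := fun r => x r - (x₀ - ε) * y r)
      (h := fun r => g r - (x₀ - ε) * (a * y r)) hα hα1 hε (abs_nonneg a)
      (hx.sub (hyc.continuousOn.const_mul _))
      (hg.sub ((hyc.continuousOn.const_mul a).const_mul _)) ?_ ?_ t ⟨ht, le_rfl⟩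
    · exact (sub_pos.1 hpos).le
    · intro r hr
      have hgr := intervalIntegrable_fractional_kernel_mul hα hr.1
        (hg.mono (Set.Icc_subset_Icc_right hr.2))
      have hyr := intervalIntegrable_fractional_kernel_mul (h := fun s => a * y s) hα hr.1
        (hyc.continuousOn.const_mul a)
      have e : ∀ s, (r - s) ^ (α - 1) * (g s - (x₀ - ε) * (a * y s)) =
          (r - s) ^ (α - 1) * g s - (x₀ - ε) * ((r - s) ^ (α - 1) * (a * y s)) := fun s => by ring
      have hyv : y r = 1 + (1 / Real.Gamma α) *
          ∫ s in (0:ℝ)..r, (r - s) ^ (α - 1) * (a * y s) :=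
        mittagLeffler_volterra hα hα1 a hr.1
      simp only [e]
      rw [intervalIntegral.integral_sub hgr (hyr.const_mul _),
        intervalIntegral.integral_const_mul, hvol r hr]
      linear_combination -(x₀ - ε) * hyv
    · intro r hr
      have h1 := neg_abs_le (a * (x r - (x₀ - ε) * y r))
      rw [abs_mul] at h1
      have h2 := hle r hr
      linarith
  have hlim : Filter.Tendsto (fun ε => (x₀ - ε) * y t) (nhdsWithin 0 (Set.Ioi 0))
      (nhds ((x₀ - 0) * y t)) :=
    (Continuous.tendsto (by fun_prop) 0).mono_left nhdsWithin_le_nhds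
  rw [sub_zero] at hlim
  exact le_of_tendsto hlim (by filter_upwards [self_mem_nhdsWithin] with ε hε using key ε hε)

theorem abs_div_le_of_lipschitz {f : ℝ → ℝ → ℝ} {T C : ℝ}
    (hC : ∀ s ∈ Set.Icc 0 T, ∀ x : ℝ, |f s x| ≤ C * |x|) {s : ℝ} (hs : s ∈ Set.Icc 0 T)
    {x : ℝ} (hx : x ≠ 0) : |f s x / x| ≤ C := by
  rw [abs_div, div_le_iff₀ (abs_pos.2 hx)]
  exact hC s hs x

theorem aLow_mul_le {f : ℝ → ℝ → ℝ} {T C t s x : ℝ}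
    (hC : ∀ s ∈ Set.Icc 0 T, ∀ x : ℝ, |f s x| ≤ C * |x|) (ht : t ≤ T) (hs : s ∈ Set.Icc 0 t)
    (hx : 0 < x) : aLow f t * x ≤ f s x := by
  rw [← le_div_iff₀ hx]
  refine csInf_le ⟨-C, ?_⟩ ⟨s, hs, x, hx.ne', rfl⟩
  rintro _ ⟨r, hr, y, hy, rfl⟩
  exact (abs_le.1 (abs_div_le_of_lipschitz hC ⟨hr.1, hr.2.trans ht⟩ hy)).1

theorem le_aHigh_mul {f : ℝ → ℝ → ℝ} {T C t s x : ℝ}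
    (hC : ∀ s ∈ Set.Icc 0 T, ∀ x : ℝ, |f s x| ≤ C * |x|) (ht : t ≤ T) (hs : s ∈ Set.Icc 0 t)
    (hx : 0 < x) : f s x ≤ aHigh f t * x := by
  rw [← div_le_iff₀ hx]
  refine le_csSup ⟨C, ?_⟩ ⟨s, hs, x, hx.ne', rfl⟩
  rintro _ ⟨r, hr, y, hy, rfl⟩
  exact (abs_le.1 (abs_div_le_of_lipschitz hC ⟨hr.1, hr.2.trans ht⟩ hy)).2

/-- Two-sided Mittag-Leffler bounds for a single solution with positive initial value. -/
theorem IsCaputoSolution.mittagLeffler_bounds {α T C x₀ : ℝ} (hα : 0 < α) (hα1 : α ≤ 1)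
    {f : ℝ → ℝ → ℝ}
    (hf : ContinuousOn (fun p : ℝ × ℝ => f p.1 p.2) (Set.Icc 0 T ×ˢ Set.univ))
    (hC0 : 0 ≤ C) (hC : ∀ s ∈ Set.Icc 0 T, ∀ x : ℝ, |f s x| ≤ C * |x|) (h₀ : 0 < x₀)
    {x : ℝ → ℝ} (hx : IsCaputoSolution α T f x₀ x) {t : ℝ} (ht : t ∈ Set.Icc 0 T) :
    x₀ * mittagLeffler α (aLow f t * t ^ α) ≤ x t ∧
      x t ≤ x₀ * mittagLeffler α (aHigh f t * t ^ α) := by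
  obtain ⟨hxc, hvol⟩ := hx
  have hg : ContinuousOn (fun s => f s (x s)) (Set.Icc 0 T) :=
    hf.comp (continuousOn_id.prodMk hxc) fun s hs => ⟨hs, Set.mem_univ _⟩
  have hpos := fractional_volterra_pos hα hα1 h₀ hC0 hxc hg hvol
    fun r hr => (abs_le.1 (hC r hr (x r))).1
  have hsub : Set.Icc 0 t ⊆ Set.Icc 0 T := Set.Icc_subset_Icc_right ht.2
  constructor
  · exact mul_mittagLeffler_le_of_supersolution hα hα1 ht.1 (hxc.mono hsub) (hg.mono hsub)
      (fun r hr => hvol r (hsub hr))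
      (fun r hr => aLow_mul_le hC ht.2 hr (hpos r (hsub hr)))
  · have h := mul_mittagLeffler_le_of_supersolution (x₀ := -x₀) (a := aHigh f t) hα hα1 ht.1
      (hxc.mono hsub).neg (hg.mono hsub).neg (fun r hr => ?_) (fun r hr => ?_)
    · simp only [Pi.neg_apply] at h
      linarith
    · simp only [Pi.neg_apply, mul_neg, intervalIntegral.integral_neg]
      rw [hvol r (hsub hr)]
      ring
    · have := le_aHigh_mul hC ht.2 hr (hpos r (hsub hr))
      simp only [Pi.neg_apply]
      linarith

/-- Separation bounds for two solutions with `0 < x₁₀ < x₂₀`. -/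
theorem caputo_separation_pos_pos (α T : ℝ) (hα : 0 < α) (hα1 : α ≤ 1) (hT : 0 < T)
    (f : ℝ → ℝ → ℝ)
    (hf : ContinuousOn (fun p : ℝ × ℝ => f p.1 p.2) (Set.Icc 0 T ×ˢ Set.univ))
    (L : ℝ → ℝ) (hLc : ContinuousOn L (Set.Icc 0 T))
    (hLnn : ∀ t ∈ Set.Icc 0 T, 0 ≤ L t)
    (hLip : ∀ t ∈ Set.Icc 0 T, ∀ x y : ℝ, |f t x - f t y| ≤ L t * |x - y|)
    (hf0 : ∀ t ∈ Set.Icc 0 T, f t 0 = 0)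
    (x₁₀ x₂₀ : ℝ) (h₁ : 0 < x₁₀) (h₂ : x₁₀ < x₂₀) (x₁ x₂ : ℝ → ℝ)
    (hx₁ : IsCaputoSolution α T f x₁₀ x₁) (hx₂ : IsCaputoSolution α T f x₂₀ x₂) :
    ∀ t ∈ Set.Icc 0 T,
      x₂₀ * mittagLeffler α (aLow f t * t ^ α)
          - x₁₀ * mittagLeffler α (aHigh f t * t ^ α) ≤ x₂ t - x₁ t ∧
        x₂ t - x₁ t ≤ x₂₀ * mittagLeffler α (aHigh f t * t ^ α)
          - x₁₀ * mittagLeffler α (aLow f t * t ^ α) := by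
  obtain ⟨C, hCb⟩ := isCompact_Icc.bddAbove_image hLc
  have hLC : ∀ s ∈ Set.Icc 0 T, L s ≤ C := fun s hs => hCb ⟨s, hs, rfl⟩
  have hC0 : 0 ≤ C := (hLnn 0 ⟨le_rfl, hT.le⟩).trans (hLC 0 ⟨le_rfl, hT.le⟩)
  have hC : ∀ s ∈ Set.Icc 0 T, ∀ x : ℝ, |f s x| ≤ C * |x| := by
    intro s hs x
    have h := hLip s hs x 0
    rw [hf0 s hs, sub_zero, sub_zero] at h
    exact h.trans (mul_le_mul_of_nonneg_right (hLC s hs) (abs_nonneg x))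
  intro t ht
  obtain ⟨l₁, u₁⟩ := hx₁.mittagLeffler_bounds hα hα1 hf hC0 hC h₁ ht
  obtain ⟨l₂, u₂⟩ := hx₂.mittagLeffler_bounds hα hα1 hf hC0 hC (h₁.trans h₂) ht
  exact ⟨by linarith, by linarith⟩
end

section
/- Let α ∈ (0,1], T > 0, and let f : [0,T] × ℝ → ℝ be continuous, satisfy the Lipschitz condition, and satisfy f(t,0) = 0 for all t ∈ [0,T]. Let x₁, x₂ be solutions on [0,T] of the Caputo fractional initial value problems with initial values x₁₀, x₂₀ satisfying x₁₀ < 0 < x₂₀. Then for all t ∈ [0,T]: (x₂₀ − x₁₀)·E_α(a_*(t) t^α) ≤ x₂(t) − x₁(t) ≤ (x₂₀ − x₁₀)·E_α(a^*(t) t^α), where a_*(t) := inf_{s ∈ [0,t], x ≠ 0} f(s,x)/x and a^*(t) := sup_{s ∈ [0,t], x ≠ 0} f(s,x)/x. -/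
open Set intervalIntegral

open Filter Topology MeasureTheory

/-- The two-parameter Mittag-Leffler function `E_{α,β}(x) = ∑_{k=0}^∞ x^k / Γ(αk+β)`. -/
noncomputable def mittagLefflerTwo (α β x : ℝ) : ℝ :=
  ∑' k : ℕ, x ^ k / Real.Gamma (α * (k : ℝ) + β)

/-- The kernel `t^{β-1} E_{α,β}(a t^α)`. -/
noncomputable def mlKernel (α β a t : ℝ) : ℝ :=
  t ^ (β - 1) * mittagLefflerTwo α β (a * t ^ α)

lemma gamma_le_gamma_add_mul_rpow_neg {α y : ℝ} (hα : 0 < α) (hα1 : α ≤ 1) (hy : 0 < y)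
    (hyα : 0 < y + α - 1) :
    Real.Gamma y ≤ Real.Gamma (y + α) * (y + α - 1) ^ (-α) := by
  have hG : Real.Gamma (y + α) = (y + α - 1) * Real.Gamma (y + α - 1) := by
    rw [← Real.Gamma_add_one hyα.ne']; ring_nf
  have hP : 0 < Real.Gamma (y + α) := Real.Gamma_pos_of_pos (by linarith)
  have hQ : Real.Gamma (y + α - 1) = Real.Gamma (y + α) * (y + α - 1) ^ (-1 : ℝ) := by
    rw [hG, Real.rpow_neg_one]; field_simp
  rcases hα1.eq_or_lt with rfl | hlt
  · rw [← hQ]; simp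
  · have h := Real.Gamma_mul_add_mul_le_rpow_Gamma_mul_rpow_Gamma hyα
      (show 0 < y + α by linarith) hα (show 0 < 1 - α by linarith) (by ring)
    have e : α * (y + α - 1) + (1 - α) * (y + α) = y := by ring
    rw [e] at h
    refine h.trans_eq ?_
    rw [hQ, Real.mul_rpow hP.le (by positivity), ← Real.rpow_mul hyα.le, mul_right_comm,
      ← Real.rpow_add hP]
    simp

lemma summable_mittagLefflerTwo {α β : ℝ} (hα : 0 < α) (hα1 : α ≤ 1) (hβ : 0 < β) (x : ℝ) :
    Summable fun k : ℕ => x ^ k / Real.Gamma (α * (k : ℝ) + β) := by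
  rcases eq_or_ne x 0 with rfl | hx
  · refine summable_of_ne_finset_zero (s := {0}) fun k hk => ?_
    rw [zero_pow (by simpa using hk), zero_div]
  have hpos : ∀ k : ℕ, 0 < Real.Gamma (α * (k : ℝ) + β) := fun k =>
    Real.Gamma_pos_of_pos (by positivity)
  have htend : Tendsto (fun k : ℕ => α * (k : ℝ) + (β + α - 1)) atTop atTop :=
    tendsto_atTop_add_const_right _ _ (tendsto_natCast_atTop_atTop.const_mul_atTop hα)
  refine summable_of_ratio_test_tendsto_lt_one (l := 0) one_pos ?_ ?_
  · exact Eventually.of_forall fun k => div_ne_zero (pow_ne_zero _ hx) (hpos k).ne'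
  · have hlim : Tendsto (fun k : ℕ => |x| * (α * (k : ℝ) + (β + α - 1)) ^ (-α)) atTop (𝓝 0) := by
      simpa using ((tendsto_rpow_neg_atTop hα).comp htend).const_mul |x|
    refine squeeze_zero' (Eventually.of_forall fun k => by positivity) ?_ hlim
    filter_upwards [htend.eventually_gt_atTop 0] with k hk
    have h := gamma_le_gamma_add_mul_rpow_neg hα hα1
      (show 0 < α * (k : ℝ) + β by positivity) (by linarith)
    have e : α * ((k + 1 : ℕ) : ℝ) + β = α * (k : ℝ) + β + α := by push_cast; ring
    have e' : α * (k : ℝ) + (β + α - 1) = α * (k : ℝ) + β + α - 1 := by ring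
    have h1 := hpos k
    have h2 := hpos (k + 1)
    rw [e] at h2
    rw [e, e', norm_div, norm_div, norm_pow, norm_pow, Real.norm_eq_abs, Real.norm_of_nonneg h1.le,
      Real.norm_of_nonneg h2.le]
    have hx' : 0 < |x| := abs_pos.mpr hx
    calc |x| ^ (k + 1) / Real.Gamma (α * k + β + α) / (|x| ^ k / Real.Gamma (α * k + β))
        = |x| * (Real.Gamma (α * k + β) / Real.Gamma (α * k + β + α)) := by field_simp; ring
      _ ≤ _ := by
        refine mul_le_mul_of_nonneg_left ?_ hx'.le
        rw [div_le_iff₀ h2]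
        exact h.trans_eq (mul_comm _ _)

lemma continuous_mittagLefflerTwo {α β : ℝ} (hα : 0 < α) (hα1 : α ≤ 1) (hβ : 0 < β) :
    Continuous (mittagLefflerTwo α β) := by
  refine continuous_iff_continuousAt.mpr fun x => ?_
  have hc : ContinuousOn (mittagLefflerTwo α β) (Metric.closedBall 0 (|x| + 1)) := by
    refine continuousOn_tsum (fun k => by fun_prop)
      (summable_mittagLefflerTwo hα hα1 hβ (|x| + 1)) fun k y hy => ?_
    have hG : 0 < Real.Gamma (α * (k : ℝ) + β) := Real.Gamma_pos_of_pos (by positivity)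
    rw [norm_div, norm_pow, Real.norm_of_nonneg hG.le]
    have : ‖y‖ ≤ |x| + 1 := by simpa using hy
    gcongr
  refine hc.continuousAt (Filter.mem_of_superset
    (Metric.isOpen_ball.mem_nhds (x := x) ?_) Metric.ball_subset_closedBall)
  simp

lemma mittagLefflerTwo_eq_add {α β : ℝ} (hα : 0 < α) (hα1 : α ≤ 1) (hβ : 0 < β) (x : ℝ) :
    mittagLefflerTwo α β x = 1 / Real.Gamma β + x * mittagLefflerTwo α (β + α) x := by
  unfold mittagLefflerTwo
  rw [(summable_mittagLefflerTwo hα hα1 hβ x).tsum_eq_zero_add, ← tsum_mul_left]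
  congr 1
  · simp
  · refine tsum_congr fun k => ?_
    rw [pow_succ', mul_div_assoc]
    congr 3
    push_cast; ring

lemma mittagLefflerTwo_zero {α β : ℝ} (hα : 0 < α) (hα1 : α ≤ 1) (hβ : 0 < β) :
    mittagLefflerTwo α β 0 = 1 / Real.Gamma β := by
  rw [mittagLefflerTwo_eq_add hα hα1 hβ]; simp

lemma mlKernel_eq_add {α β a t : ℝ} (hα : 0 < α) (hα1 : α ≤ 1) (hβ : 0 < β) (ht : 0 < t) :
    mlKernel α β a t = t ^ (β - 1) / Real.Gamma β + a * mlKernel α (β + α) a t := by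
  unfold mlKernel
  rw [mittagLefflerTwo_eq_add hα hα1 hβ, show β + α - 1 = (β - 1) + α by ring, Real.rpow_add ht]
  ring

lemma continuous_mlKernel_factor {α β : ℝ} (hα : 0 < α) (hα1 : α ≤ 1) (hβ : 0 < β) (a : ℝ) :
    Continuous fun t : ℝ => mittagLefflerTwo α β (a * t ^ α) :=
  (continuous_mittagLefflerTwo hα hα1 hβ).comp
    (continuous_const.mul (continuous_id.rpow_const fun _ => Or.inr hα.le))

lemma intervalIntegrable_mlKernel {α β : ℝ} (hα : 0 < α) (hα1 : α ≤ 1) (hβ : 0 < β) (a t : ℝ) :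
    IntervalIntegrable (mlKernel α β a) volume 0 t :=
  (intervalIntegrable_rpow' (by linarith)).mul_continuousOn
    (continuous_mlKernel_factor hα hα1 hβ a).continuousOn

lemma intervalIntegrable_sub_rpow {p : ℝ} (hp : 0 < p) (t a b : ℝ) :
    IntervalIntegrable (fun s : ℝ => (t - s) ^ (p - 1)) volume a b := by
  have h : IntervalIntegrable (fun s : ℝ => s ^ (p - 1)) volume (t - a) (t - b) :=
    intervalIntegrable_rpow' (by linarith)
  simpa using h.comp_sub_left t

lemma intervalIntegrable_sub_rpow_mul_rpow {p q t : ℝ} (hp : 0 < p) (hq : 0 < q) (ht : 0 < t) :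
    IntervalIntegrable (fun s : ℝ => (t - s) ^ (p - 1) * s ^ (q - 1)) volume 0 t := by
  refine IntervalIntegrable.trans (b := t / 2) ?_ ?_
  · refine (intervalIntegrable_rpow' (by linarith)).continuousOn_mul ?_
    refine ContinuousOn.rpow_const (by fun_prop) fun s hs => Or.inl ?_
    rw [uIcc_of_le (by linarith)] at hs
    linarith [hs.2]
  · refine (intervalIntegrable_sub_rpow hp t _ _).mul_continuousOn ?_
    refine ContinuousOn.rpow_const (by fun_prop) fun s hs => Or.inl ?_
    rw [uIcc_of_le (by linarith)] at hs
    linarith [hs.1]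

lemma integral_sub_rpow_mul_rpow {p q t : ℝ} (hp : 0 < p) (hq : 0 < q) (ht : 0 < t) :
    ∫ s in (0 : ℝ)..t, (t - s) ^ (p - 1) * s ^ (q - 1) =
      Real.Gamma p * Real.Gamma q / Real.Gamma (q + p) * t ^ (q + p - 1) := by
  have h := Complex.betaIntegral_scaled (q : ℂ) (p : ℂ) ht
  rw [Complex.betaIntegral_eq_Gamma_mul_div _ _ (by simpa) (by simpa)] at h
  have e : ∀ s ∈ uIcc 0 t, ((s : ℂ)) ^ ((q : ℂ) - 1) * ((t : ℂ) - s) ^ ((p : ℂ) - 1) =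
      (((t - s) ^ (p - 1) * s ^ (q - 1) : ℝ) : ℂ) := by
    intro s hs
    rw [uIcc_of_le ht.le] at hs
    rw [Complex.ofReal_mul, Complex.ofReal_cpow hs.1, Complex.ofReal_cpow (by linarith [hs.2])]
    push_cast
    ring
  rw [intervalIntegral.integral_congr e, intervalIntegral.integral_ofReal,
    Complex.Gamma_ofReal, Complex.Gamma_ofReal, ← Complex.ofReal_add, Complex.Gamma_ofReal,
    ← Complex.ofReal_one, ← Complex.ofReal_sub, ← Complex.ofReal_cpow ht.le] at h
  apply Complex.ofReal_injective
  rw [h]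
  push_cast
  ring

lemma intervalIntegrable_sub_rpow_mul_mlKernel {α β p t : ℝ} (hα : 0 < α) (hα1 : α ≤ 1)
    (hβ : 0 < β) (hp : 0 < p) (ht : 0 < t) (a : ℝ) :
    IntervalIntegrable (fun s : ℝ => (t - s) ^ (p - 1) * mlKernel α β a s) volume 0 t := by
  simp_rw [mlKernel, ← mul_assoc]
  exact (intervalIntegrable_sub_rpow_mul_rpow hp hβ ht).mul_continuousOn
    (continuous_mlKernel_factor hα hα1 hβ a).continuousOn

/-- Fractional integration of order `p` sends the kernel with parameter `β` to the kernel with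
parameter `β + p`. -/
lemma integral_sub_rpow_mul_mlKernel {α β p t : ℝ} (hα : 0 < α) (hα1 : α ≤ 1)
    (hβ : 0 < β) (hp : 0 < p) (ht : 0 < t) (a : ℝ) :
    ∫ s in (0 : ℝ)..t, (t - s) ^ (p - 1) * mlKernel α β a s =
      Real.Gamma p * mlKernel α (β + p) a t := by
  have hG : ∀ (γ : ℝ), 0 < γ → ∀ k : ℕ, 0 < Real.Gamma (α * (k : ℝ) + γ) := fun γ hγ k =>
    Real.Gamma_pos_of_pos (by positivity)
  set F : ℕ → ℝ → ℝ := fun k s =>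
    a ^ k / Real.Gamma (α * k + β) * ((t - s) ^ (p - 1) * s ^ (α * k + β - 1)) with hF
  have hpow : ∀ k : ℕ, t ^ (α * k + β + p - 1) = t ^ (β + p - 1) * (t ^ α) ^ k := fun k => by
    rw [← Real.rpow_mul_natCast ht.le, ← Real.rpow_add ht]; ring_nf
  have hint : ∀ (c : ℝ) (k : ℕ),
      ∫ s in (0 : ℝ)..t, c ^ k / Real.Gamma (α * k + β) *
        ((t - s) ^ (p - 1) * s ^ (α * k + β - 1)) =
      Real.Gamma p * t ^ (β + p - 1) * ((c * t ^ α) ^ k / Real.Gamma (α * k + (β + p))) := by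
    intro c k
    have h1 := hG β hβ k
    have h2 := hG (β + p) (by positivity) k
    rw [intervalIntegral.integral_const_mul,
      integral_sub_rpow_mul_rpow hp (by positivity) ht, hpow, mul_pow,
      ← add_assoc (α * (k : ℝ))]
    rw [← add_assoc (α * (k : ℝ))] at h2
    field_simp
  have hFint : ∀ k, Integrable (F k) (volume.restrict (Ioc 0 t)) := fun k =>
    ((intervalIntegrable_iff_integrableOn_Ioc_of_le ht.le).mp
      ((intervalIntegrable_sub_rpow_mul_rpow hp (q := α * k + β) (by positivity) ht).const_mul _))
  have hnorm : ∀ k, ∫ s in Ioc 0 t, ‖F k s‖ =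
      Real.Gamma p * t ^ (β + p - 1) * ((|a| * t ^ α) ^ k / Real.Gamma (α * k + (β + p))) := by
    intro k
    rw [← hint, intervalIntegral.integral_of_le ht.le]
    refine setIntegral_congr_fun measurableSet_Ioc fun s hs => ?_
    have h1 := hG β hβ k
    have h3 : 0 ≤ (t - s) ^ (p - 1) * s ^ (α * k + β - 1) :=
      mul_nonneg (Real.rpow_nonneg (by linarith [hs.2]) _) (Real.rpow_nonneg hs.1.le _)
    simp only [hF]
    rw [norm_mul, norm_div, norm_pow, Real.norm_of_nonneg h1.le, Real.norm_of_nonneg h3,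
      Real.norm_eq_abs]
  have hsum := hasSum_integral_of_summable_integral_norm hFint (by
    simp_rw [hnorm]
    exact (summable_mittagLefflerTwo hα hα1 (by positivity) _).mul_left _)
  have hL : ∫ s in Ioc 0 t, ∑' k, F k s =
      ∫ s in (0 : ℝ)..t, (t - s) ^ (p - 1) * mlKernel α β a s := by
    rw [intervalIntegral.integral_of_le ht.le]
    refine setIntegral_congr_fun measurableSet_Ioc fun s hs => ?_
    simp only [hF, mlKernel, mittagLefflerTwo]
    rw [← mul_assoc, ← tsum_mul_left]
    refine tsum_congr fun k => ?_
    rw [mul_pow, ← Real.rpow_mul_natCast hs.1.le,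
      show α * (k : ℝ) + β - 1 = (β - 1) + α * k by ring, Real.rpow_add hs.1]
    ring
  rw [← hL, ← hsum.tsum_eq, mlKernel, mittagLefflerTwo, ← mul_assoc, ← tsum_mul_left]
  refine tsum_congr fun k => ?_
  rw [← hint, intervalIntegral.integral_of_le ht.le]

lemma mittagLefflerTwo_pos_of_nonneg {α β : ℝ} (hα : 0 < α) (hα1 : α ≤ 1) (hβ : 0 < β) {x : ℝ}
    (hx : 0 ≤ x) : 0 < mittagLefflerTwo α β x := by
  refine (summable_mittagLefflerTwo hα hα1 hβ x).tsum_pos (fun k => ?_) 0 ?_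
  · have := Real.Gamma_pos_of_pos (show 0 < α * (k : ℝ) + β by positivity)
    positivity
  · simpa using Real.Gamma_pos_of_pos hβ

/-- Positivity of `E_{α,β}` on the whole real line for `0 < α ≤ 1` and `α ≤ β`; on the negative
half-line the Volterra equation of the kernel is compared at a first zero and at an earlier
local maximum. -/
lemma mittagLefflerTwo_pos {α β : ℝ} (hα : 0 < α) (hα1 : α ≤ 1) (hβ : α ≤ β) (x : ℝ) :
    0 < mittagLefflerTwo α β x := by
  have hβ0 : 0 < β := hα.trans_le hβ
  rcases le_or_gt 0 x with hx | hx
  · exact mittagLefflerTwo_pos_of_nonneg hα hα1 hβ0 hx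
  by_contra! hneg
  have hgc := continuous_mlKernel_factor hα hα1 hβ0 (-1)
  set g : ℝ → ℝ := fun t => mittagLefflerTwo α β (-1 * t ^ α) with hg
  set S : Set ℝ := Ici 0 ∩ {t | g t ≤ 0} with hS
  have hScl : IsClosed S := isClosed_Ici.inter (isClosed_le hgc continuous_const)
  have hSne : S.Nonempty := by
    refine ⟨(-x) ^ α⁻¹, Real.rpow_nonneg (by linarith) _, ?_⟩
    change mittagLefflerTwo α β (-1 * ((-x) ^ α⁻¹) ^ α) ≤ 0
    rw [← Real.rpow_mul (by linarith), inv_mul_cancel₀ hα.ne', Real.rpow_one]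
    simpa using hneg
  have hSb : BddBelow S := ⟨0, fun t ht => ht.1⟩
  obtain ⟨h0, h1⟩ := hScl.csInf_mem hSne hSb
  set t₁ := sInf S
  have ht₁ : 0 < t₁ := by
    refine lt_of_le_of_ne h0 fun h => ?_
    have hz : g t₁ = 1 / Real.Gamma β := by
      simp only [hg, ← h, Real.zero_rpow hα.ne', mul_zero, mittagLefflerTwo_zero hα hα1 hβ0]
    have hGβ := Real.Gamma_pos_of_pos hβ0
    have : 0 < 1 / Real.Gamma β := by positivity
    exact absurd (hz.ge.trans h1) (not_le.mpr this)
  set U := mlKernel α β (-1) with hU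
  have hUpos : ∀ t, 0 < t → t < t₁ → 0 < U t := by
    intro t ht htt
    refine mul_pos (Real.rpow_pos_of_pos ht _) ?_
    by_contra! hc
    exact absurd (csInf_le hSb ⟨ht.le, hc⟩) (not_le.mpr htt)
  have hU1 : U t₁ ≤ 0 := mul_nonpos_of_nonneg_of_nonpos (Real.rpow_nonneg h0 _) h1
  have hUc : ContinuousOn U (Ioi 0) :=
    (ContinuousOn.rpow_const continuousOn_id fun s hs => Or.inl (ne_of_gt hs)).mul hgc.continuousOn
  have hΓ : 0 < Real.Gamma α := Real.Gamma_pos_of_pos hα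
  obtain ⟨τ₀, hτ₀, hτ₀l, hτ₀r⟩ :
      ∃ s, (t₁ - s) ^ α < α * Real.Gamma α / 2 ∧ t₁ / 2 < s ∧ s < t₁ := by
    have hc : Tendsto (fun s : ℝ => (t₁ - s) ^ α) (𝓝[<] t₁) (𝓝 0) := by
      have : Continuous fun s : ℝ => (t₁ - s) ^ α :=
        (continuous_const.sub continuous_id).rpow_const fun _ => Or.inr hα.le
      have h := this.tendsto t₁
      rw [sub_self, Real.zero_rpow hα.ne'] at h
      exact h.mono_left nhdsWithin_le_nhds
    have e1 := hc.eventually_lt_const (show 0 < α * Real.Gamma α / 2 by positivity)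
    have e2 : ∀ᶠ s in 𝓝[<] t₁, s ∈ Ioo (t₁ / 2) t₁ := Ioo_mem_nhdsLT (by linarith)
    obtain ⟨s, hs1, hs2⟩ := (e1.and e2).exists
    exact ⟨s, hs1, hs2.1, hs2.2⟩
  obtain ⟨τ, hτ, hmax⟩ := isCompact_Icc.exists_isMaxOn (nonempty_Icc.mpr hτ₀r.le)
    (hUc.mono fun s hs => (by linarith [hs.1] : (0 : ℝ) < s))
  have hτpos : 0 < τ := by linarith [hτ.1]
  have hUτ : 0 < U τ := (hUpos τ₀ (by linarith) hτ₀r).trans_le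
    (hmax (left_mem_Icc.mpr hτ₀r.le))
  have hττ : τ < t₁ := lt_of_le_of_ne hτ.2 fun h => by rw [h] at hUτ; linarith
  have heq : ∀ t, 0 < t → Real.Gamma α * U t = Real.Gamma α / Real.Gamma β * t ^ (β - 1) -
      ∫ s in (0 : ℝ)..t, (t - s) ^ (α - 1) * U s := by
    intro t ht
    rw [hU, integral_sub_rpow_mul_mlKernel hα hα1 hβ0 hα ht, mlKernel_eq_add hα hα1 hβ0 ht]
    ring
  set ρ := (τ / t₁) ^ (1 - α) with hρ
  have hρ0 : 0 ≤ ρ := by positivity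
  have hquot : τ / t₁ ≤ 1 := (div_le_one ht₁).mpr hττ.le
  have hρhalf : 1 / 2 ≤ ρ := by
    calc 1 / 2 ≤ τ / t₁ := by rw [le_div_iff₀ ht₁]; linarith [hτ.1]
      _ = (τ / t₁) ^ (1 : ℝ) := (Real.rpow_one _).symm
      _ ≤ ρ := Real.rpow_le_rpow_of_exponent_ge (by positivity) hquot (by linarith)
  have hforce : ρ * τ ^ (β - 1) ≤ t₁ ^ (β - 1) := by
    rw [hρ, Real.div_rpow hτpos.le h0, div_mul_eq_mul_div, div_le_iff₀ (by positivity),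
      ← Real.rpow_add hτpos, ← Real.rpow_add ht₁, add_comm (β - 1)]
    exact Real.rpow_le_rpow hτpos.le hττ.le (by linarith)
  have hint := intervalIntegrable_sub_rpow_mul_mlKernel hα hα1 hβ0 hα ht₁ (-1)
  have hint1 : IntervalIntegrable (fun s => (t₁ - s) ^ (α - 1) * U s) volume 0 τ :=
    hint.mono_set (by
      rw [uIcc_of_le hτpos.le, uIcc_of_le h0]; exact Icc_subset_Icc le_rfl hττ.le)
  have hint2 : IntervalIntegrable (fun s => (t₁ - s) ^ (α - 1) * U s) volume τ t₁ :=
    hint.mono_set (by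
      rw [uIcc_of_le hττ.le, uIcc_of_le h0]; exact Icc_subset_Icc hτpos.le le_rfl)
  have hpast : ∫ s in (0 : ℝ)..τ, (t₁ - s) ^ (α - 1) * U s ≤
      ρ * ∫ s in (0 : ℝ)..τ, (τ - s) ^ (α - 1) * U s := by
    rw [← intervalIntegral.integral_const_mul]
    refine intervalIntegral.integral_mono_on_of_le_Ioo hτpos.le hint1
      ((intervalIntegrable_sub_rpow_mul_mlKernel hα hα1 hβ0 hα hτpos (-1)).const_mul _)
      fun s hs => ?_
    rw [← mul_assoc]
    refine mul_le_mul_of_nonneg_right ?_ (hUpos s hs.1 (hs.2.trans hττ)).le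
    have hs1 : 0 < τ - s := by linarith [hs.2]
    have hs2 : 0 < t₁ - s := by linarith
    have hk : ((τ - s) / (t₁ - s)) ^ (1 - α) ≤ ρ := by
      refine Real.rpow_le_rpow (by positivity) ?_ (by linarith)
      rw [div_le_div_iff₀ hs2 ht₁]
      nlinarith [hs.1]
    rw [Real.div_rpow hs1.le hs2.le, div_le_iff₀ (by positivity)] at hk
    rw [show α - 1 = -(1 - α) by ring, Real.rpow_neg hs1.le, Real.rpow_neg hs2.le,
      ← div_eq_mul_inv, le_div_iff₀ (by positivity), inv_mul_le_iff₀ (by positivity), mul_comm]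
    exact hk
  have hrecent : ∫ s in τ..t₁, (t₁ - s) ^ (α - 1) * U s ≤ (t₁ - τ) ^ α / α * U τ := by
    have hI : ∫ s in τ..t₁, (t₁ - s) ^ (α - 1) = (t₁ - τ) ^ α / α := by
      rw [intervalIntegral.integral_comp_sub_left (fun s : ℝ => s ^ (α - 1)),
        integral_rpow (Or.inl (by linarith))]
      simp [Real.zero_rpow hα.ne']
    rw [← hI, ← intervalIntegral.integral_mul_const]
    refine intervalIntegral.integral_mono_on hττ.le hint2
      ((intervalIntegrable_sub_rpow hα t₁ τ t₁).mul_const _) fun s hs => ?_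
    exact mul_le_mul_of_nonneg_left (hmax ⟨hτ.1.trans hs.1, hs.2⟩)
      (Real.rpow_nonneg (by linarith [hs.2]) _)
  have hsplit := intervalIntegral.integral_add_adjacent_intervals hint1 hint2
  have e1 := heq t₁ ht₁
  have e2 := heq τ hτpos
  rw [← hsplit] at e1
  have hsmall : (t₁ - τ) ^ α / α < Real.Gamma α / 2 := by
    rw [div_lt_iff₀ hα]
    have := Real.rpow_le_rpow (sub_nonneg.mpr hττ.le) (sub_le_sub_left hτ.1 t₁) hα.le
    linarith
  have hGβ := Real.Gamma_pos_of_pos hβ0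
  have f1 : ρ * (Real.Gamma α / Real.Gamma β * τ ^ (β - 1)) ≤
      Real.Gamma α / Real.Gamma β * t₁ ^ (β - 1) := by
    rw [mul_left_comm]
    exact mul_le_mul_of_nonneg_left hforce (by positivity)
  have f2 : (t₁ - τ) ^ α / α * U τ < Real.Gamma α / 2 * U τ :=
    mul_lt_mul_of_pos_right hsmall hUτ
  have f3 : 1 / 2 * (Real.Gamma α * U τ) ≤ ρ * (Real.Gamma α * U τ) :=
    mul_le_mul_of_nonneg_right hρhalf (by positivity)
  have f4 : Real.Gamma α * U t₁ ≤ 0 := mul_nonpos_of_nonneg_of_nonpos hΓ.le hU1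
  rw [e2] at f3
  nlinarith

/-- Associativity of the one-sided convolution of two integrable kernels with a continuous
function. -/
lemma integral_mul_integral_sub_eq {e k φ : ℝ → ℝ} {t : ℝ} (ht : 0 < t)
    (he : IntervalIntegrable e volume 0 t) (hk : IntervalIntegrable k volume 0 t)
    (hφ : ContinuousOn φ (Icc 0 t)) :
    ∫ s in (0 : ℝ)..t, e s * (∫ r in (0 : ℝ)..(t - s), k r * φ (t - s - r)) =
      ∫ s in (0 : ℝ)..t, (∫ r in (0 : ℝ)..s, e r * k (s - r)) * φ (t - s) := by
  set E := indicator (Ioc 0 t) e with hE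
  set K := indicator (Ioc 0 t) k with hK
  set Φ := indicator (Icc 0 t) φ with hΦ
  have hEi : Integrable E := (integrable_indicator_iff measurableSet_Ioc).mpr
    ((intervalIntegrable_iff_integrableOn_Ioc_of_le ht.le).mp he)
  have hKi : Integrable K := (integrable_indicator_iff measurableSet_Ioc).mpr
    ((intervalIntegrable_iff_integrableOn_Ioc_of_le ht.le).mp hk)
  have hΦi : Integrable Φ := (integrable_indicator_iff measurableSet_Icc).mpr
    hφ.integrableOn_Icc
  obtain ⟨C, hC⟩ := isCompact_Icc.exists_bound_of_continuousOn hφ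
  have hΦb : ∀ s, ‖Φ s‖ ≤ max C 0 := by
    intro s
    by_cases hs : s ∈ Icc 0 t
    · rw [hΦ, indicator_of_mem hs]; exact (hC s hs).trans (le_max_left _ _)
    · rw [hΦ, indicator_of_notMem hs]; simp
  have hassoc := convolution_assoc' (f := E) (g := K) (k := Φ) (μ := volume) (ν := volume)
    (ContinuousLinearMap.mul ℝ ℝ) (ContinuousLinearMap.mul ℝ ℝ) (ContinuousLinearMap.mul ℝ ℝ)
    (ContinuousLinearMap.mul ℝ ℝ) (x₀ := t) (fun x y z => by simp [mul_assoc])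
    (hEi.ae_convolution_exists _ hKi) (hKi.ae_convolution_exists _ hΦi) (by
      have h := (hEi.convolution_integrand (ContinuousLinearMap.mul ℝ ℝ) hKi).mul_bdd
        (g := fun p : ℝ × ℝ => Φ (t - p.1)) (c := max C 0) ?_
        (Eventually.of_forall fun p => hΦb _)
      · refine h.congr (Eventually.of_forall fun p => ?_)
        simp [Function.uncurry, mul_assoc]
      · exact ((hΦi.comp_sub_left t).aestronglyMeasurable).comp_fst)
  simp only [convolution, ContinuousLinearMap.mul_apply'] at hassoc
  have hl : ∫ s in (0 : ℝ)..t, e s * (∫ r in (0 : ℝ)..(t - s), k r * φ (t - s - r)) =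
      ∫ s, E s * ∫ r, K r * Φ (t - s - r) := by
    rw [intervalIntegral.integral_of_le ht.le, ← MeasureTheory.integral_indicator measurableSet_Ioc]
    refine integral_congr_ae (Eventually.of_forall fun s => ?_)
    by_cases hs : s ∈ Ioc 0 t
    · simp only [hE, indicator_of_mem hs]
      congr 1
      rw [intervalIntegral.integral_of_le (by linarith [hs.2]),
        ← MeasureTheory.integral_indicator measurableSet_Ioc]
      refine integral_congr_ae (Eventually.of_forall fun r => ?_)
      by_cases hr : r ∈ Ioc 0 (t - s)
      · have h1 : r ∈ Ioc 0 t := ⟨hr.1, by linarith [hr.2, hs.1]⟩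
        have h2 : t - s - r ∈ Icc 0 t := ⟨by linarith [hr.2], by linarith [hr.1, hs.1]⟩
        simp only [hK, hΦ, indicator_of_mem hr, indicator_of_mem h1, indicator_of_mem h2]
      · simp only [indicator_of_notMem hr]
        by_cases h1 : r ∈ Ioc 0 t
        · have h2 : t - s - r ∉ Icc 0 t := fun h => hr ⟨h1.1, by linarith [h.1]⟩
          simp only [hΦ, indicator_of_notMem h2, mul_zero]
        · simp only [hK, indicator_of_notMem h1, zero_mul]
    · simp only [hE, indicator_of_notMem hs, zero_mul]
  have hr : ∫ s in (0 : ℝ)..t, (∫ r in (0 : ℝ)..s, e r * k (s - r)) * φ (t - s) =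
      ∫ s, (∫ r, E r * K (s - r)) * Φ (t - s) := by
    rw [intervalIntegral.integral_of_le ht.le, ← integral_Icc_eq_integral_Ioc,
      ← MeasureTheory.integral_indicator measurableSet_Icc]
    refine integral_congr_ae (Eventually.of_forall fun s => ?_)
    by_cases hs : s ∈ Icc 0 t
    · have h1 : t - s ∈ Icc 0 t := ⟨by linarith [hs.2], by linarith [hs.1]⟩
      simp only [hΦ, indicator_of_mem hs, indicator_of_mem h1]
      congr 1
      rw [intervalIntegral.integral_of_le hs.1, integral_Ioc_eq_integral_Ioo,
        ← MeasureTheory.integral_indicator measurableSet_Ioo]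
      refine integral_congr_ae (Eventually.of_forall fun r => ?_)
      by_cases hr : r ∈ Ioo 0 s
      · have h2 : r ∈ Ioc 0 t := ⟨hr.1, by linarith [hr.2, hs.2]⟩
        have h3 : s - r ∈ Ioc 0 t := ⟨by linarith [hr.2], by linarith [hr.1, hs.2]⟩
        simp only [hE, hK, indicator_of_mem hr, indicator_of_mem h2, indicator_of_mem h3]
      · simp only [indicator_of_notMem hr]
        by_cases h2 : r ∈ Ioc 0 t
        · have h3 : s - r ∉ Ioc 0 t := fun h => hr ⟨h2.1, by linarith [h.1]⟩
          simp only [hK, indicator_of_notMem h3, mul_zero]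
        · simp only [hE, indicator_of_notMem h2, zero_mul]
    · have h1 : t - s ∉ Icc 0 t := fun h => hs ⟨by linarith [h.2], by linarith [h.1]⟩
      simp only [hΦ, indicator_of_notMem hs, indicator_of_notMem h1, mul_zero]
  rw [hl, hr, hassoc]

/-- Variation of constants for the Volterra form of the fractional equation
`^C D^α w = φ = a w + (φ - a w)`, `w(0) = w₀`. -/
lemma eq_mittagLeffler_add_integral {α a w₀ t : ℝ} (hα : 0 < α) (hα1 : α ≤ 1) (ht : 0 < t)
    {w φ : ℝ → ℝ} (hwc : ContinuousOn w (Icc 0 t)) (hφ : ContinuousOn φ (Icc 0 t))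
    (hw : ∀ s ∈ Icc 0 t,
      w s = w₀ + (1 / Real.Gamma α) * ∫ r in (0 : ℝ)..s, (s - r) ^ (α - 1) * φ r) :
    w t = w₀ * mittagLeffler α (a * t ^ α) +
      ∫ s in (0 : ℝ)..t, mlKernel α α a s * (φ (t - s) - a * w (t - s)) := by
  have hΓ : 0 < Real.Gamma α := Real.Gamma_pos_of_pos hα
  set e := mlKernel α α a with he
  have hei : IntervalIntegrable e volume 0 t := intervalIntegrable_mlKernel hα hα1 hα a t
  have hsub : ∀ {g : ℝ → ℝ}, ContinuousOn g (Icc 0 t) →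
      ContinuousOn (fun s => g (t - s)) (uIcc 0 t) := fun hg => by
    rw [uIcc_of_le ht.le]
    exact hg.comp (by fun_prop) fun s hs => ⟨by linarith [hs.2], by linarith [hs.1]⟩
  have hconv : ∀ u ∈ Icc 0 t, ∫ r in (0 : ℝ)..u, r ^ (α - 1) * φ (u - r) =
      Real.Gamma α * (w u - w₀) := by
    intro u hu
    have h := intervalIntegral.integral_comp_sub_left (a := 0) (b := u)
      (fun r => (u - r) ^ (α - 1) * φ r) u
    simp only [sub_sub_cancel, sub_self, sub_zero] at h
    rw [h, hw u hu]
    field_simp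
    ring
  have hassoc := integral_mul_integral_sub_eq ht hei
    (intervalIntegrable_rpow' (r := α - 1) (by linarith)) hφ
  have hl : ∫ s in (0 : ℝ)..t, e s * (∫ r in (0 : ℝ)..(t - s), r ^ (α - 1) * φ (t - s - r)) =
      Real.Gamma α * ((∫ s in (0 : ℝ)..t, e s * w (t - s)) - w₀ * ∫ s in (0 : ℝ)..t, e s) := by
    rw [← intervalIntegral.integral_const_mul w₀,
      ← intervalIntegral.integral_sub (hei.mul_continuousOn (hsub hwc)) (hei.const_mul _),
      ← intervalIntegral.integral_const_mul]
    refine intervalIntegral.integral_congr fun s hs => ?_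
    rw [uIcc_of_le ht.le] at hs
    rw [hconv (t - s) ⟨by linarith [hs.2], by linarith [hs.1]⟩]
    ring
  have hki : IntervalIntegrable (fun s : ℝ => s ^ (α - 1)) volume 0 t :=
    intervalIntegrable_rpow' (by linarith)
  have hr : a * ∫ s in (0 : ℝ)..t, (∫ r in (0 : ℝ)..s, e r * (s - r) ^ (α - 1)) * φ (t - s) =
      Real.Gamma α * (∫ s in (0 : ℝ)..t, e s * φ (t - s)) - Real.Gamma α * (w t - w₀) := by
    rw [← hconv t (right_mem_Icc.mpr ht.le), ← intervalIntegral.integral_const_mul,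
      ← intervalIntegral.integral_const_mul,
      ← intervalIntegral.integral_sub ((hei.mul_continuousOn (hsub hφ)).const_mul _)
        (hki.mul_continuousOn (hsub hφ))]
    rw [intervalIntegral.integral_of_le ht.le, intervalIntegral.integral_of_le ht.le]
    refine setIntegral_congr_fun measurableSet_Ioc fun s hs => ?_
    have h1 := integral_sub_rpow_mul_mlKernel hα hα1 hα hα hs.1 a
    have h2 := mlKernel_eq_add (a := a) hα hα1 hα hs.1
    simp only [mul_comm (e _)]
    rw [he, h1, h2]
    field_simp
    ring
  have hone : mittagLeffler α (a * t ^ α) = 1 + a * ∫ s in (0 : ℝ)..t, e s := by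
    have h1 := integral_sub_rpow_mul_mlKernel hα hα1 hα one_pos ht a
    have h2 := mittagLefflerTwo_eq_add hα hα1 one_pos (a * t ^ α)
    simp only [sub_self, Real.rpow_zero, one_mul, Real.Gamma_one] at h1
    rw [he, h1]
    simp only [Real.Gamma_one, div_one] at h2
    rw [mlKernel, add_sub_cancel_right, ← mul_assoc, add_comm α 1, ← h2]
    rfl
  have hfin : ∫ s in (0 : ℝ)..t, e s * (φ (t - s) - a * w (t - s)) =
      (∫ s in (0 : ℝ)..t, e s * φ (t - s)) - a * ∫ s in (0 : ℝ)..t, e s * w (t - s) := by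
    rw [← intervalIntegral.integral_const_mul,
      ← intervalIntegral.integral_sub (hei.mul_continuousOn (hsub hφ))
        ((hei.mul_continuousOn (hsub hwc)).const_mul _)]
    congr 1
    ext s
    ring
  rw [hl] at hassoc
  rw [← hassoc] at hr
  have hr' : a * ((∫ s in (0 : ℝ)..t, e s * w (t - s)) - w₀ * ∫ s in (0 : ℝ)..t, e s) =
      (∫ s in (0 : ℝ)..t, e s * φ (t - s)) - (w t - w₀) := by
    apply mul_left_cancel₀ hΓ.ne'
    linarith
  rw [hfin, hone]
  linarith

lemma mittagLeffler_le_of_le {α a w₀ t : ℝ} (hα : 0 < α) (hα1 : α ≤ 1) (ht : 0 < t)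
    {w φ : ℝ → ℝ} (hwc : ContinuousOn w (Icc 0 t)) (hφ : ContinuousOn φ (Icc 0 t))
    (hw : ∀ s ∈ Icc 0 t,
      w s = w₀ + (1 / Real.Gamma α) * ∫ r in (0 : ℝ)..s, (s - r) ^ (α - 1) * φ r)
    (h : ∀ s ∈ Ioo 0 t, a * w s ≤ φ s) :
    w₀ * mittagLeffler α (a * t ^ α) ≤ w t := by
  rw [eq_mittagLeffler_add_integral (a := a) hα hα1 ht hwc hφ hw,
    intervalIntegral.integral_of_le ht.le, integral_Ioc_eq_integral_Ioo]
  refine le_add_of_nonneg_right (setIntegral_nonneg measurableSet_Ioo fun s hs => ?_)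
  refine mul_nonneg (mul_nonneg (Real.rpow_nonneg hs.1.le _)
    (mittagLefflerTwo_pos hα hα1 le_rfl _).le) ?_
  exact sub_nonneg.mpr (h _ ⟨by linarith [hs.2], by linarith [hs.1]⟩)

lemma le_mittagLeffler_of_le {α a w₀ t : ℝ} (hα : 0 < α) (hα1 : α ≤ 1) (ht : 0 < t)
    {w φ : ℝ → ℝ} (hwc : ContinuousOn w (Icc 0 t)) (hφ : ContinuousOn φ (Icc 0 t))
    (hw : ∀ s ∈ Icc 0 t,
      w s = w₀ + (1 / Real.Gamma α) * ∫ r in (0 : ℝ)..s, (s - r) ^ (α - 1) * φ r)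
    (h : ∀ s ∈ Ioo 0 t, φ s ≤ a * w s) :
    w t ≤ w₀ * mittagLeffler α (a * t ^ α) := by
  have := mittagLeffler_le_of_le (a := a) (w₀ := -w₀) hα hα1 ht hwc.neg hφ.neg
    (fun s hs => by
      simp only [Pi.neg_apply, mul_neg, intervalIntegral.integral_neg]
      rw [hw s hs]; ring)
    (fun s hs => by simpa using h s hs)
  simpa using this

/-- A solution with positive initial value and a right-hand side dominated by `M |w|` stays
positive. -/
lemma pos_of_abs_le {α M w₀ T : ℝ} (hα : 0 < α) (hα1 : α ≤ 1) (hw₀ : 0 < w₀)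
    {w φ : ℝ → ℝ} (hwc : ContinuousOn w (Icc 0 T)) (hφ : ContinuousOn φ (Icc 0 T))
    (hw : ∀ s ∈ Icc 0 T,
      w s = w₀ + (1 / Real.Gamma α) * ∫ r in (0 : ℝ)..s, (s - r) ^ (α - 1) * φ r)
    (hM : ∀ s ∈ Icc 0 T, |φ s| ≤ M * |w s|) :
    ∀ t ∈ Icc 0 T, 0 < w t := by
  by_contra! hcon
  obtain ⟨t, ht, hwt⟩ := hcon
  set S : Set ℝ := Icc 0 T ∩ w ⁻¹' Iic 0 with hS
  have hScl : IsClosed S := hwc.preimage_isClosed_of_isClosed isClosed_Icc isClosed_Iic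
  have hSb : BddBelow S := ⟨0, fun s hs => hs.1.1⟩
  obtain ⟨h0, h1⟩ := hScl.csInf_mem ⟨t, ht, hwt⟩ hSb
  set t₁ := sInf S
  have h1' : w t₁ ≤ 0 := h1
  have ht₁ : 0 < t₁ := by
    refine lt_of_le_of_ne h0.1 fun h => ?_
    have := hw 0 (h ▸ h0)
    rw [← h] at h1'
    simp at this
    linarith
  have hsub : Icc 0 t₁ ⊆ Icc 0 T := Icc_subset_Icc le_rfl h0.2
  have hle := mittagLeffler_le_of_le (a := -M) hα hα1 ht₁ (hwc.mono hsub) (hφ.mono hsub)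
    (fun s hs => hw s (hsub hs)) (fun s hs => by
      have hsT := hsub (Ioo_subset_Icc_self hs)
      have hpos : 0 < w s := by
        by_contra! hc
        exact absurd (csInf_le hSb ⟨hsT, hc⟩) (not_le.mpr hs.2)
      have := hM s hsT
      rw [abs_of_pos hpos] at this
      linarith [neg_abs_le (φ s)])
  have hml : 0 < mittagLeffler α (-M * t₁ ^ α) := mittagLefflerTwo_pos hα hα1 hα1 _
  have := mul_pos hw₀ hml
  linarith

/-- Separation bounds for two solutions with `x₁₀ < 0 < x₂₀`. -/
theorem caputo_separation_neg_pos (α T : ℝ) (hα : 0 < α) (hα1 : α ≤ 1) (hT : 0 < T)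
    (f : ℝ → ℝ → ℝ)
    (hf : ContinuousOn (fun p : ℝ × ℝ => f p.1 p.2) (Set.Icc 0 T ×ˢ Set.univ))
    (L : ℝ → ℝ) (hLc : ContinuousOn L (Set.Icc 0 T))
    (hLnn : ∀ t ∈ Set.Icc 0 T, 0 ≤ L t)
    (hLip : ∀ t ∈ Set.Icc 0 T, ∀ x y : ℝ, |f t x - f t y| ≤ L t * |x - y|)
    (hf0 : ∀ t ∈ Set.Icc 0 T, f t 0 = 0)
    (x₁₀ x₂₀ : ℝ) (h₁ : x₁₀ < 0) (h₂ : 0 < x₂₀) (x₁ x₂ : ℝ → ℝ)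
    (hx₁ : IsCaputoSolution α T f x₁₀ x₁) (hx₂ : IsCaputoSolution α T f x₂₀ x₂) :
    ∀ t ∈ Set.Icc 0 T,
      (x₂₀ - x₁₀) * mittagLeffler α (aLow f t * t ^ α) ≤ x₂ t - x₁ t ∧
        x₂ t - x₁ t ≤ (x₂₀ - x₁₀) * mittagLeffler α (aHigh f t * t ^ α) := by
  obtain ⟨M, hLM⟩ := isCompact_Icc.exists_bound_of_continuousOn hLc
  have hfM : ∀ s ∈ Icc 0 T, ∀ x, |f s x| ≤ M * |x| := fun s hs x => by
    have h := hLip s hs x 0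
    rw [hf0 s hs, sub_zero, sub_zero] at h
    exact h.trans (mul_le_mul_of_nonneg_right ((le_abs_self _).trans (hLM s hs)) (abs_nonneg x))
  have hfc : ∀ {x : ℝ → ℝ}, ContinuousOn x (Icc 0 T) → ContinuousOn (fun s => f s (x s))
      (Icc 0 T) := fun hx => hf.comp (continuousOn_id.prodMk hx) fun s hs => ⟨hs, mem_univ _⟩
  obtain ⟨hc₁, hw₁⟩ := hx₁
  obtain ⟨hc₂, hw₂⟩ := hx₂
  have hφ₂ := hfc hc₂
  have hφ₁ : ContinuousOn (fun s => -f s (x₁ s)) (Icc 0 T) := (hfc hc₁).neg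
  have hc₁' : ContinuousOn (fun s => -x₁ s) (Icc 0 T) := hc₁.neg
  have hw₁' : ∀ s ∈ Icc 0 T, -x₁ s = -x₁₀ + (1 / Real.Gamma α) *
      ∫ r in (0 : ℝ)..s, (s - r) ^ (α - 1) * -f r (x₁ r) := fun s hs => by
    simp only [mul_neg, intervalIntegral.integral_neg]
    rw [hw₁ s hs]; ring
  have hpos₂ := pos_of_abs_le hα hα1 h₂ hc₂ hφ₂ hw₂ fun s hs => hfM s hs _
  have hpos₁ := pos_of_abs_le (M := M) hα hα1 (neg_pos.mpr h₁) hc₁' hφ₁ hw₁' fun s hs => by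
    simpa using hfM s hs (x₁ s)
  intro t ht
  rcases ht.1.eq_or_lt with rfl | htpos
  · have e₁ := hw₁ 0 ht
    have e₂ := hw₂ 0 ht
    simp only [intervalIntegral.integral_same, mul_zero, add_zero] at e₁ e₂
    have hone : mittagLeffler α 0 = 1 := by
      have := mittagLefflerTwo_zero hα hα1 one_pos
      rwa [Real.Gamma_one, div_one] at this
    simp [Real.zero_rpow hα.ne', hone, e₁, e₂]
  have hsub : Icc 0 t ⊆ Icc 0 T := Icc_subset_Icc le_rfl ht.2
  have hratio : ∀ s ∈ Icc 0 t, ∀ x : ℝ, x ≠ 0 → |f s x / x| ≤ M := fun s hs x hx => by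
    rw [abs_div, div_le_iff₀ (abs_pos.mpr hx)]
    exact hfM s (hsub hs) x
  have hlow : ∀ s ∈ Icc 0 t, ∀ x : ℝ, x ≠ 0 → aLow f t ≤ f s x / x := fun s hs x hx => by
    refine csInf_le ⟨-M, ?_⟩ ⟨s, hs, x, hx, rfl⟩
    rintro _ ⟨r, hr, y, hy, rfl⟩
    exact (abs_le.mp (hratio r hr y hy)).1
  have hhigh : ∀ s ∈ Icc 0 t, ∀ x : ℝ, x ≠ 0 → f s x / x ≤ aHigh f t := fun s hs x hx => by
    refine le_csSup ⟨M, ?_⟩ ⟨s, hs, x, hx, rfl⟩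
    rintro _ ⟨r, hr, y, hy, rfl⟩
    exact (abs_le.mp (hratio r hr y hy)).2
  have lo₂ := mittagLeffler_le_of_le (a := aLow f t) hα hα1 htpos (hc₂.mono hsub)
    (hφ₂.mono hsub) (fun s hs => hw₂ s (hsub hs)) (fun s hs => by
      have hs' := Ioo_subset_Icc_self hs
      have hp := hpos₂ s (hsub hs')
      exact (le_div_iff₀ hp).mp (hlow s hs' _ hp.ne'))
  have hi₂ := le_mittagLeffler_of_le (a := aHigh f t) hα hα1 htpos (hc₂.mono hsub)
    (hφ₂.mono hsub) (fun s hs => hw₂ s (hsub hs)) (fun s hs => by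
      have hs' := Ioo_subset_Icc_self hs
      have hp := hpos₂ s (hsub hs')
      exact (div_le_iff₀ hp).mp (hhigh s hs' _ hp.ne'))
  have lo₁ := mittagLeffler_le_of_le (a := aLow f t) hα hα1 htpos (hc₁'.mono hsub)
    (hφ₁.mono hsub) (fun s hs => hw₁' s (hsub hs)) (fun s hs => by
      have hs' := Ioo_subset_Icc_self hs
      have hp := hpos₁ s (hsub hs')
      have h := hlow s hs' (x₁ s) (neg_pos.mp hp).ne
      rwa [← neg_div_neg_eq, le_div_iff₀ hp] at h)
  have hi₁ := le_mittagLeffler_of_le (a := aHigh f t) hα hα1 htpos (hc₁'.mono hsub)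
    (hφ₁.mono hsub) (fun s hs => hw₁' s (hsub hs)) (fun s hs => by
      have hs' := Ioo_subset_Icc_self hs
      have hp := hpos₁ s (hsub hs')
      have h := hhigh s hs' (x₁ s) (neg_pos.mp hp).ne
      rwa [← neg_div_neg_eq, div_le_iff₀ hp] at h)
  constructor <;> linarith
end

section
/- Let α ∈ (0,1] and let f : [0,∞) × ℝ → ℝ be continuous, satisfy the Lipschitz condition on [0,∞), and satisfy f(t,0) = 0 for all t ≥ 0. Suppose sup_{t ≥ 0} a^*(t) < 0, where a^*(t) := sup_{s ∈ [0,t], x ≠ 0} f(s,x)/x. Then every solution x on [0,∞) of the Caputo fractional differential equation ^C D^α_{0+} x(t) = f(t, x(t)) satisfies lim_{t → ∞} x(t) = 0. -/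
open Set intervalIntegral

/-- A continuous function `x` on `[0,∞)` solves the Caputo fractional initial value
problem `^C D^α_{0+} x(t) = f(t,x(t))`, `x(0) = x₀`, in the equivalent Volterra
integral formulation, on the whole half line. -/
def IsCaputoSolutionIci (α : ℝ) (f : ℝ → ℝ → ℝ) (x₀ : ℝ) (x : ℝ → ℝ) : Prop :=
  ContinuousOn x (Set.Ici 0) ∧
    ∀ t ∈ Set.Ici (0:ℝ),
      x t = x₀ + (1 / Real.Gamma α) * ∫ s in (0:ℝ)..t, (t - s) ^ (α - 1) * f s (x s)

open MeasureTheory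

/-- The Euler beta integral `∫₀¹ z ^ p * (1 - z) ^ q dz`, parametrized by its exponents. -/
noncomputable def eulerBeta (p q : ℝ) : ℝ := ∫ z in Ioo (0:ℝ) 1, z ^ p * (1 - z) ^ q

lemma integrableOn_eulerBeta {p q : ℝ} (hp : -1 < p) (hq : -1 < q) :
    IntegrableOn (fun z : ℝ => z ^ p * (1 - z) ^ q) (Ioo 0 1) := by
  have h := Complex.betaIntegral_convergent (u := ((p + 1 : ℝ) : ℂ)) (v := ((q + 1 : ℝ) : ℂ))
    (by simp; linarith) (by simp; linarith)
  rw [intervalIntegrable_iff_integrableOn_Ioo_of_le zero_le_one] at h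
  refine IntegrableOn.congr_fun h.norm (fun z hz => ?_) measurableSet_Ioo
  have h1 : (0:ℝ) < 1 - z := sub_pos.2 hz.2
  have e1 : (z : ℂ) ^ (((p + 1 : ℝ) : ℂ) - 1) = ((z ^ p : ℝ) : ℂ) := by
    rw [Complex.ofReal_cpow hz.1.le]; push_cast; ring_nf
  have e2 : (1 - (z : ℂ)) ^ (((q + 1 : ℝ) : ℂ) - 1) = (((1 - z) ^ q : ℝ) : ℂ) := by
    rw [Complex.ofReal_cpow h1.le]; push_cast; ring_nf
  simp only [e1, e2]
  rw [← Complex.ofReal_mul, Complex.norm_real, Real.norm_of_nonneg]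
  have := hz.1
  positivity

lemma eulerBeta_pos {p q : ℝ} (hp : -1 < p) (hq : -1 < q) : 0 < eulerBeta p q := by
  have hpos : ∀ z ∈ Ioo (0:ℝ) 1, 0 < z ^ p * (1 - z) ^ q := fun z hz =>
    mul_pos (Real.rpow_pos_of_pos hz.1 _) (Real.rpow_pos_of_pos (sub_pos.2 hz.2) _)
  rw [eulerBeta, setIntegral_pos_iff_support_of_nonneg_ae
    (ae_restrict_of_forall_mem measurableSet_Ioo fun z hz => (hpos z hz).le)
    (integrableOn_eulerBeta hp hq)]
  have hsub : Ioo (0:ℝ) 1 ⊆ Function.support fun z : ℝ => z ^ p * (1 - z) ^ q :=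
    fun z hz => (hpos z hz).ne'
  rw [inter_eq_self_of_subset_right hsub]
  simp

/-- A change of variables mapping an open interval onto `(0, 1)` transports the beta integral. -/
lemma eulerBeta_of_image {p q s τ c : ℝ} {φ φ' g : ℝ → ℝ} (hp : -1 < p) (hq : -1 < q)
    (hc : c ≠ 0) (himg : φ '' Ioo s τ = Ioo 0 1) (hinj : InjOn φ (Ioo s τ))
    (hφ : ∀ σ ∈ Ioo s τ, HasDerivAt φ (φ' σ) σ)
    (hg : ∀ σ ∈ Ioo s τ, |φ' σ| * (φ σ ^ p * (1 - φ σ) ^ q) = c * g σ) :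
    IntegrableOn g (Ioo s τ) ∧ ∫ σ in Ioo s τ, g σ = c⁻¹ * eulerBeta p q := by
  have hφ' : ∀ σ ∈ Ioo s τ, HasDerivWithinAt φ (φ' σ) (Ioo s τ) σ :=
    fun σ hσ => (hφ σ hσ).hasDerivWithinAt
  constructor
  · have h := integrableOn_eulerBeta hp hq
    rw [← himg, integrableOn_image_iff_integrableOn_abs_deriv_smul measurableSet_Ioo hφ' hinj] at h
    refine IntegrableOn.congr_fun (h.const_mul c⁻¹) (fun σ hσ => ?_) measurableSet_Ioo
    simp only [smul_eq_mul]
    rw [hg σ hσ, inv_mul_cancel_left₀ hc]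
  · rw [eulerBeta, ← himg,
      integral_image_eq_integral_abs_deriv_smul measurableSet_Ioo hφ' hinj,
      ← MeasureTheory.integral_const_mul]
    refine setIntegral_congr_fun measurableSet_Ioo fun σ hσ => ?_
    simp only [smul_eq_mul]
    rw [hg σ hσ, inv_mul_cancel_left₀ hc]

lemma eulerBeta_scaled {p q t : ℝ} (hp : -1 < p) (hq : -1 < q) (ht : 0 < t) :
    IntegrableOn (fun s : ℝ => (t - s) ^ q * s ^ p) (Ioo 0 t) ∧
      ∫ s in Ioo 0 t, (t - s) ^ q * s ^ p = t ^ (p + q + 1) * eulerBeta p q := by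
  have h := eulerBeta_of_image (p := p) (q := q) (s := 0) (τ := t) (c := (t ^ (p + q + 1))⁻¹)
    (φ := fun s => s / t) (φ' := fun _ => 1 / t) (g := fun s => (t - s) ^ q * s ^ p) hp hq
    (by positivity) ?_ ?_ ?_ ?_
  · simpa using h
  · ext z
    constructor
    · rintro ⟨s, hs, rfl⟩
      exact ⟨div_pos hs.1 ht, (div_lt_one ht).2 hs.2⟩
    · intro hz
      refine ⟨z * t, ⟨mul_pos hz.1 ht, ?_⟩, by field_simp⟩
      nlinarith [hz.2]
  · intro a _ b _ hab
    have : a / t = b / t := hab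
    field_simp at this
    exact this
  · intro s _
    exact (hasDerivAt_id s).div_const t
  · intro s hs
    have h1 : 0 < t - s := sub_pos.2 hs.2
    have e : 1 - s / t = (t - s) / t := by field_simp
    simp only [e]
    rw [Real.div_rpow hs.1.le ht.le, Real.div_rpow h1.le ht.le, abs_of_pos (by positivity),
      Real.rpow_add ht, Real.rpow_add ht, Real.rpow_one]
    field_simp

/-- Fractional Poisson kernel: for `s < τ < T` the kernel `(T - s) ^ (α - 1)` is a positive
superposition of the kernels `(σ - s) ^ (α - 1)` with `σ ∈ (s, τ)`. -/
lemma fractional_poisson {α s τ T : ℝ} (hα : 0 < α) (hα1 : α < 1) (hs : s < τ) (hT : τ < T) :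
    IntegrableOn (fun σ : ℝ => (τ - σ) ^ (-α) * (T - σ)⁻¹ * (σ - s) ^ (α - 1)) (Ioo s τ) ∧
      ∫ σ in Ioo s τ, (τ - σ) ^ (-α) * (T - σ)⁻¹ * (σ - s) ^ (α - 1) =
        (T - τ) ^ (-α) * eulerBeta (α - 1) (-α) * (T - s) ^ (α - 1) := by
  have a1 : 0 < τ - s := by linarith
  have a2 : 0 < T - τ := by linarith
  have a3 : 0 < T - s := by linarith
  have h := eulerBeta_of_image (p := α - 1) (q := -α) (s := s) (τ := τ)
    (c := (T - τ) ^ α * (T - s) ^ (1 - α))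
    (φ := fun σ => (σ - s) * (T - τ) / ((τ - s) * (T - σ)))
    (φ' := fun σ => (T - τ) * (T - s) / ((τ - s) * (T - σ) ^ 2))
    (g := fun σ => (τ - σ) ^ (-α) * (T - σ)⁻¹ * (σ - s) ^ (α - 1)) (by linarith) (by linarith)
    (by positivity) ?_ ?_ ?_ ?_
  · refine ⟨h.1, h.2.trans ?_⟩
    rw [mul_inv, ← Real.rpow_neg a2.le, ← Real.rpow_neg a3.le, neg_sub]
    ring
  · ext z
    constructor
    · rintro ⟨σ, hσ, rfl⟩
      have b1 : 0 < σ - s := sub_pos.2 hσ.1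
      have b2 : 0 < τ - σ := sub_pos.2 hσ.2
      have b3 : 0 < T - σ := by linarith
      refine ⟨by positivity, (div_lt_one (by positivity)).2 ?_⟩
      nlinarith [mul_pos b2 a3]
    · intro hz
      have d : 0 < (T - τ) + z * (τ - s) := by nlinarith [hz.1, mul_pos hz.1 a1]
      refine ⟨s + z * (τ - s) * (T - s) / ((T - τ) + z * (τ - s)), ⟨?_, ?_⟩, ?_⟩
      · have := hz.1
        have : 0 < z * (τ - s) * (T - s) / ((T - τ) + z * (τ - s)) := by positivity
        linarith
      · rw [← lt_sub_iff_add_lt', div_lt_iff₀ d]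
        nlinarith [mul_pos (mul_pos a1 a2) (sub_pos.2 hz.2)]
      · have e : T - (s + z * (τ - s) * (T - s) / ((T - τ) + z * (τ - s))) =
            (T - s) * (T - τ) / ((T - τ) + z * (τ - s)) := by
          field_simp; ring
        simp only [e]
        field_simp
        ring
  · intro a ha b hb hab
    have b3 : 0 < T - a := by linarith [ha.2]
    have b4 : 0 < T - b := by linarith [hb.2]
    simp only at hab
    rw [div_eq_div_iff (by positivity) (by positivity)] at hab
    have : (τ - s) * (T - τ) * (T - s) * (a - b) = 0 := by linear_combination hab
    have h0 : (τ - s) * (T - τ) * (T - s) ≠ 0 := by positivity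
    linarith [(mul_eq_zero.1 this).resolve_left h0]
  · intro σ hσ
    have b3 : 0 < T - σ := by linarith [hσ.2]
    have h1 : HasDerivAt (fun σ => (σ - s) * (T - τ)) (T - τ) σ := by
      simpa using ((hasDerivAt_id σ).sub_const s).mul_const (T - τ)
    have h2 : HasDerivAt (fun σ => (τ - s) * (T - σ)) (-(τ - s)) σ := by
      simpa using ((hasDerivAt_id σ).const_sub T).const_mul (τ - s)
    refine (h1.fun_div h2 (by positivity)).congr_deriv ?_
    have : 0 < (τ - s) * (T - σ) := by positivity
    field_simp
    ring
  · intro σ hσ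
    have b1 : 0 < σ - s := sub_pos.2 hσ.1
    have b2 : 0 < τ - σ := sub_pos.2 hσ.2
    have b3 : 0 < T - σ := by linarith
    have e : 1 - (σ - s) * (T - τ) / ((τ - s) * (T - σ)) =
        (T - s) * (τ - σ) / ((τ - s) * (T - σ)) := by
      field_simp; ring
    simp only [e]
    rw [abs_of_pos (by positivity), Real.div_rpow (by positivity) (by positivity),
      Real.div_rpow (by positivity) (by positivity), Real.mul_rpow b1.le a2.le,
      Real.mul_rpow a1.le b3.le, Real.mul_rpow a3.le b2.le, Real.mul_rpow a1.le b3.le]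
    simp only [Real.rpow_neg a1.le, Real.rpow_neg a3.le,
      Real.rpow_neg b2.le, Real.rpow_neg b3.le,
      Real.rpow_sub a1, Real.rpow_sub a2, Real.rpow_sub a3,
      Real.rpow_sub b1, Real.rpow_sub b3, Real.rpow_one]
    field_simp

/-- If the fractional integral of `p` is nonnegative on `(0, τ)`, then the contribution of `(0, τ)`
to the fractional integral of `p` at any later time is nonnegative. -/
lemma setIntegral_rpow_mul_nonneg {α τ T : ℝ} {p : ℝ → ℝ} (hα : 0 < α) (hα1 : α < 1)
    (hT : τ < T) (hp : IntegrableOn p (Ioo 0 τ))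
    (hw : ∀ σ ∈ Ioo 0 τ, 0 ≤ ∫ s in Ioo 0 σ, (σ - s) ^ (α - 1) * p s) :
    0 ≤ ∫ s in Ioo 0 τ, (T - s) ^ (α - 1) * p s := by
  set q : ℝ → ℝ := fun σ => (τ - σ) ^ (-α) * (T - σ)⁻¹ with hq
  set C := (T - τ) ^ (-α) * eulerBeta (α - 1) (-α) with hC
  have hC0 : 0 < C :=
    mul_pos (Real.rpow_pos_of_pos (sub_pos.2 hT) _) (eulerBeta_pos (by linarith) (by linarith))
  have hq0 : ∀ σ ∈ Ioo 0 τ, 0 ≤ q σ := fun σ hσ =>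
    mul_nonneg (Real.rpow_nonneg (sub_nonneg.2 hσ.2.le) _)
      (inv_nonneg.2 (by linarith [hσ.2]))
  set Φ : ℝ × ℝ → ℝ := {z : ℝ × ℝ | z.1 < z.2}.indicator
    (fun z => q z.2 * (z.2 - z.1) ^ (α - 1)) with hΦ
  have hΦm : Measurable Φ :=
    Measurable.indicator (by fun_prop) (measurableSet_lt measurable_fst measurable_snd)
  have hΦ1 : ∀ s, (fun σ => Φ (s, σ)) =
      (Ioi s).indicator (fun σ => q σ * (σ - s) ^ (α - 1)) := fun s => by
    ext σ; simp [hΦ, indicator]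
  have hΦ2 : ∀ σ, (fun s => Φ (s, σ)) =
      (Iio σ).indicator (fun s => q σ * (σ - s) ^ (α - 1)) := fun σ => by
    ext s; simp [hΦ, indicator]
  have hi1 : ∀ s ∈ Ioo 0 τ, Ioi s ∩ Ioo 0 τ = Ioo s τ := fun s hs => by
    ext σ; simp only [mem_inter_iff, mem_Ioi, mem_Ioo]
    exact ⟨fun h => ⟨h.1, h.2.2⟩, fun h => ⟨h.1, hs.1.trans h.1, h.2⟩⟩
  have hi2 : ∀ σ ∈ Ioo 0 τ, Iio σ ∩ Ioo 0 τ = Ioo 0 σ := fun σ hσ => by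
    ext s; simp only [mem_inter_iff, mem_Iio, mem_Ioo]
    exact ⟨fun h => ⟨h.2.1, h.1⟩, fun h => ⟨h.2, h.1, h.2.trans hσ.2⟩⟩
  have hΦint : ∀ s ∈ Ioo 0 τ, IntegrableOn (fun σ => Φ (s, σ)) (Ioo 0 τ) := fun s hs => by
    rw [hΦ1, IntegrableOn, integrable_indicator_iff measurableSet_Ioi, IntegrableOn,
      Measure.restrict_restrict measurableSet_Ioi, hi1 s hs]
    exact (fractional_poisson hα hα1 hs.2 hT).1
  have hΦval : ∀ s ∈ Ioo 0 τ, ∫ σ in Ioo 0 τ, Φ (s, σ) = C * (T - s) ^ (α - 1) := fun s hs => by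
    rw [hΦ1, MeasureTheory.integral_indicator measurableSet_Ioi,
      Measure.restrict_restrict measurableSet_Ioi, hi1 s hs]
    exact (fractional_poisson hα hα1 hs.2 hT).2
  have hΦ0 : ∀ s, ∀ σ ∈ Ioo 0 τ, 0 ≤ Φ (s, σ) := fun s σ hσ =>
    indicator_apply_nonneg fun h => mul_nonneg (hq0 σ hσ)
      (Real.rpow_nonneg (sub_nonneg.2 (le_of_lt h)) _)
  have hkp : IntegrableOn (fun s => (T - s) ^ (α - 1) * ‖p s‖) (Ioo 0 τ) := by
    rw [← integrableOn_Icc_iff_integrableOn_Ioo] at hp ⊢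
    refine IntegrableOn.continuousOn_mul ?_ hp.norm isCompact_Icc
    refine ContinuousOn.rpow_const (by fun_prop) fun s hs => Or.inl ?_
    have := hs.2
    linarith
  have hF : Integrable (Function.uncurry fun s σ => Φ (s, σ) * p s)
      ((volume.restrict (Ioo 0 τ)).prod (volume.restrict (Ioo 0 τ))) := by
    have hm : AEStronglyMeasurable (Function.uncurry fun s σ => Φ (s, σ) * p s)
        ((volume.restrict (Ioo 0 τ)).prod (volume.restrict (Ioo 0 τ))) :=
      hΦm.aestronglyMeasurable.mul hp.aestronglyMeasurable.comp_fst
    rw [integrable_prod_iff hm]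
    refine ⟨ae_restrict_of_forall_mem measurableSet_Ioo fun s hs => (hΦint s hs).mul_const (p s), ?_⟩
    refine IntegrableOn.congr_fun (hkp.const_mul C) (fun s hs => ?_) measurableSet_Ioo
    simp only [Function.uncurry_apply_pair, norm_mul]
    rw [MeasureTheory.integral_mul_const, ← mul_assoc, ← hΦval s hs]
    congr 1
    exact setIntegral_congr_fun measurableSet_Ioo fun σ hσ =>
      (Real.norm_of_nonneg (hΦ0 s σ hσ)).symm
  have hswap := integral_integral_swap hF
  have hl : ∫ s in Ioo 0 τ, ∫ σ in Ioo 0 τ, Φ (s, σ) * p s =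
      C * ∫ s in Ioo 0 τ, (T - s) ^ (α - 1) * p s := by
    rw [← MeasureTheory.integral_const_mul]
    refine setIntegral_congr_fun measurableSet_Ioo fun s hs => ?_
    simp only [MeasureTheory.integral_mul_const]
    rw [hΦval s hs, mul_assoc]
  have hr : 0 ≤ ∫ σ in Ioo 0 τ, ∫ s in Ioo 0 τ, Φ (s, σ) * p s := by
    refine setIntegral_nonneg measurableSet_Ioo fun σ hσ => ?_
    have e : (fun s => Φ (s, σ) * p s) =
        (Iio σ).indicator (fun s => q σ * ((σ - s) ^ (α - 1) * p s)) := by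
      ext s
      rw [show Φ (s, σ) = _ from congrFun (hΦ2 σ) s]
      by_cases h : s ∈ Iio σ
      · simp only [indicator_of_mem h, mul_assoc]
      · simp only [indicator_of_notMem h, zero_mul]
    rw [e, MeasureTheory.integral_indicator measurableSet_Iio, Measure.restrict_restrict measurableSet_Iio,
      hi2 σ hσ, MeasureTheory.integral_const_mul]
    exact mul_nonneg (hq0 σ hσ) (hw σ hσ)
  rw [← hswap, hl] at hr
  exact nonneg_of_mul_nonneg_right hr hC0

/-- Fractional minimum principle: if the fractional integral of `p` is nonnegative before `T` and
`p` is positive just before `T`, then the fractional integral of `p` is positive at `T`. -/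
lemma setIntegral_rpow_mul_pos {α T : ℝ} {p : ℝ → ℝ} (hα : 0 < α) (hα1 : α < 1)
    (hT : 0 < T) (hp : IntegrableOn p (Ioo 0 T))
    (hkp : IntegrableOn (fun s => (T - s) ^ (α - 1) * p s) (Ioo 0 T))
    (hw : ∀ σ ∈ Ioo 0 T, 0 ≤ ∫ s in Ioo 0 σ, (σ - s) ^ (α - 1) * p s)
    (hpT : ∀ᶠ s in nhdsWithin T (Iio T), 0 < p s) :
    0 < ∫ s in Ioo 0 T, (T - s) ^ (α - 1) * p s := by
  obtain ⟨l, hl, hlp⟩ := (mem_nhdsLT_iff_exists_Ioo_subset' hT).1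
    (Filter.inter_mem hpT (Ioo_mem_nhdsLT hT))
  have hlT : l < T := hl
  set τ := (max l 0 + T) / 2 with hτ
  have hm : max l 0 < T := max_lt hlT hT
  have hτl : l < τ := by have := le_max_left l 0; linarith
  have hτ0 : 0 < τ := by have := le_max_right l 0; linarith
  have hτT : τ < T := by linarith
  rw [← Ioc_union_Ioo_eq_Ioo hτ0.le hτT, setIntegral_union
    (disjoint_left.2 fun s h1 h2 => (h2.1.not_ge h1.2)) measurableSet_Ioo
    (hkp.mono_set (Ioc_subset_Ioo_right hτT)) (hkp.mono_set (Ioo_subset_Ioo_left hτ0.le)),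
    integral_Ioc_eq_integral_Ioo]
  refine add_pos_of_nonneg_of_pos (setIntegral_rpow_mul_nonneg hα hα1 hτT
    (hp.mono_set (Ioo_subset_Ioo_right hτT.le))
    fun σ hσ => hw σ ⟨hσ.1, hσ.2.trans hτT⟩) ?_
  have hpos : ∀ s ∈ Ioo τ T, 0 < (T - s) ^ (α - 1) * p s := fun s hs =>
    mul_pos (Real.rpow_pos_of_pos (sub_pos.2 hs.2) _) (hlp ⟨hτl.trans hs.1, hs.2⟩).1
  rw [setIntegral_pos_iff_support_of_nonneg_ae
    (ae_restrict_of_forall_mem measurableSet_Ioo fun s hs => (hpos s hs).le)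
    (hkp.mono_set (Ioo_subset_Ioo_left hτ0.le))]
  have hsub : Ioo τ T ⊆ Function.support fun s : ℝ => (T - s) ^ (α - 1) * p s :=
    fun s hs => (hpos s hs).ne'
  rw [inter_eq_self_of_subset_right hsub]
  simpa using hτT

/-- Solutions of a dissipative fractional Volterra equation of order `α < 1` are bounded above by
a negative power of time. -/
lemma exists_le_rpow_of_volterra {α c x₀ : ℝ} {x G : ℝ → ℝ} (hα : 0 < α) (hα1 : α < 1)
    (hc : 0 < c) (hx : ContinuousOn x (Ici 0)) (hG : ContinuousOn G (Ici 0))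
    (hxG : ∀ t, 0 ≤ t → x t = x₀ + ∫ s in Ioo 0 t, (t - s) ^ (α - 1) * G s)
    (hneg : ∀ t, 0 ≤ t → 0 < x t → G t ≤ -c * x t) :
    ∃ β : ℝ, 0 < β ∧ ∃ K, ∀ t, 1 ≤ t → x t ≤ K * t ^ (-β) := by
  obtain ⟨β, hβ, hβα, hβ1⟩ : ∃ β, 0 < β ∧ β ≤ α ∧ α + β < 1 := by
    refine ⟨min α (1 - α) / 2, ?_, ?_, ?_⟩
    · have := lt_min hα (sub_pos.2 hα1); linarith
    · have := min_le_left α (1 - α); linarith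
    · have := min_le_right α (1 - α); linarith
  set D := eulerBeta (-(α + β)) (α - 1) with hD
  set B := eulerBeta (-α) (α - 1) with hB
  have hD0 : 0 < D := eulerBeta_pos (by linarith) (by linarith)
  have hB0 : 0 < B := eulerBeta_pos (by linarith) (by linarith)
  obtain ⟨M, hM⟩ := (isCompact_Icc (a := (0:ℝ)) (b := 1)).bddAbove_image
    (hx.mono Icc_subset_Ici_self)
  set K := |M| + 1 + |x₀| / (B * c) with hK
  have hK0 : 0 < K := by positivity
  set p : ℝ → ℝ := fun s => K / D * s ^ (-(α + β)) - x₀ / B * s ^ (-α) - G s with hp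
  have hker : ∀ t, 0 < t → IntegrableOn (fun s : ℝ => (t - s) ^ (α - 1)) (Ioo 0 t) :=
    fun t ht => by
      simpa using (eulerBeta_scaled (p := 0) (q := α - 1) (by norm_num) (by linarith) ht).1
  have hrpow : ∀ r : ℝ, -1 < r → ∀ t, 0 < t → IntegrableOn (fun s : ℝ => s ^ r) (Ioo 0 t) :=
    fun r hr t ht => (intervalIntegral.integrableOn_Ioo_rpow_iff ht).2 hr
  have hGt : ∀ t, ContinuousOn G (Icc 0 t) := fun t => hG.mono Icc_subset_Ici_self
  have hpint : ∀ t, 0 < t → IntegrableOn p (Ioo 0 t) := fun t ht =>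
    (((hrpow _ (by linarith) t ht).const_mul _).sub
      ((hrpow _ (by linarith) t ht).const_mul _)).sub
      ((hGt t).integrableOn_Icc.mono_set Ioo_subset_Icc_self)
  have hkG : ∀ t, 0 < t → IntegrableOn (fun s => (t - s) ^ (α - 1) * G s) (Ioo 0 t) :=
    fun t ht => by
      have := hker t ht
      rw [← integrableOn_Icc_iff_integrableOn_Ioo] at this ⊢
      exact this.mul_continuousOn (hGt t) isCompact_Icc
  have hk1 := fun t (ht : 0 < t) => eulerBeta_scaled (p := -(α + β)) (q := α - 1)
    (by linarith) (by linarith) ht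
  have hk2 := fun t (ht : 0 < t) => eulerBeta_scaled (p := -α) (q := α - 1)
    (by linarith) (by linarith) ht
  have hkp_eq : ∀ t, (fun s => (t - s) ^ (α - 1) * p s) = fun s =>
      K / D * ((t - s) ^ (α - 1) * s ^ (-(α + β))) - x₀ / B * ((t - s) ^ (α - 1) * s ^ (-α)) -
        (t - s) ^ (α - 1) * G s := fun t => by
    ext s; simp only [hp]; ring
  have hk12 : ∀ t, 0 < t → IntegrableOn (fun s => K / D * ((t - s) ^ (α - 1) * s ^ (-(α + β))) -
      x₀ / B * ((t - s) ^ (α - 1) * s ^ (-α))) (Ioo 0 t) := fun t ht =>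
    ((hk1 t ht).1.const_mul _).sub ((hk2 t ht).1.const_mul _)
  have hkp : ∀ t, 0 < t → IntegrableOn (fun s => (t - s) ^ (α - 1) * p s) (Ioo 0 t) :=
    fun t ht => by
      rw [hkp_eq]
      exact (hk12 t ht).sub (hkG t ht)
  have hval : ∀ t, 0 < t →
      ∫ s in Ioo 0 t, (t - s) ^ (α - 1) * p s = K * t ^ (-β) - x t := fun t ht => by
    rw [hkp_eq, MeasureTheory.integral_sub (hk12 t ht) (hkG t ht),
      MeasureTheory.integral_sub ((hk1 t ht).1.const_mul _) ((hk2 t ht).1.const_mul _),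
      MeasureTheory.integral_const_mul, MeasureTheory.integral_const_mul,
      (hk1 t ht).2, (hk2 t ht).2, hxG t ht.le, ← hD, ← hB,
      show -(α + β) + (α - 1) + 1 = -β by ring, show -α + (α - 1) + 1 = 0 by ring,
      Real.rpow_zero]
    field_simp
    ring
  refine ⟨β, hβ, K, ?_⟩
  by_contra! hcon
  obtain ⟨t₁, ht₁, hxt₁⟩ := hcon
  have hwc : ContinuousOn (fun t => K * t ^ (-β) - x t) (Icc 1 t₁) := by
    refine ContinuousOn.sub (continuousOn_const.mul
      (ContinuousOn.rpow_const (by fun_prop) fun s hs => Or.inl ?_))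
      (hx.mono fun s hs => ?_)
    · have := hs.1; linarith
    · exact zero_le_one.trans hs.1
  obtain ⟨T, ⟨hTm, hTw⟩, hTl⟩ := (isCompact_Icc.of_isClosed_subset
    (hwc.preimage_isClosed_of_isClosed isClosed_Icc (isClosed_Iic (a := (0:ℝ))))
    inter_subset_left).exists_isLeast ⟨t₁, ⟨ht₁, le_rfl⟩, by simpa using hxt₁.le⟩
  have hT0 : 0 < T := zero_lt_one.trans_le hTm.1
  have hxT : K * T ^ (-β) ≤ x T := by simpa using hTw
  have hw : ∀ σ ∈ Ioo 0 T, 0 ≤ ∫ s in Ioo 0 σ, (σ - s) ^ (α - 1) * p s := fun σ hσ => by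
    rw [hval σ hσ.1]
    rcases le_total σ 1 with h | h
    · have h1 : x σ ≤ M := hM ⟨σ, ⟨hσ.1.le, h⟩, rfl⟩
      have h2 : 1 ≤ σ ^ (-β) := Real.one_le_rpow_of_pos_of_le_one_of_nonpos hσ.1 h (by linarith)
      have h3 : M ≤ K := by
        have : 0 ≤ |x₀| / (B * c) := by positivity
        linarith [le_abs_self M]
      nlinarith
    · by_contra! hlt
      exact hσ.2.not_ge (hTl ⟨⟨h, hσ.2.le.trans hTm.2⟩, hlt.le⟩)
  have hpT : 0 < p T := by
    have h1 : 0 < T ^ (-β) := Real.rpow_pos_of_pos hT0 _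
    have h2 : G T ≤ -c * x T := hneg T hT0.le ((mul_pos hK0 h1).trans_le hxT)
    have h3 : T ^ (-α) ≤ T ^ (-β) := Real.rpow_le_rpow_of_exponent_le hTm.1 (by linarith)
    have h4 : 0 < K / D * T ^ (-(α + β)) :=
      mul_pos (div_pos hK0 hD0) (Real.rpow_pos_of_pos hT0 _)
    have h5 : |x₀| / B ≤ c * K := by
      have : c * (|x₀| / (B * c)) = |x₀| / B := by field_simp
      rw [hK, mul_add, this]
      have : 0 ≤ c * (|M| + 1) := by positivity
      linarith
    have h6 : x₀ / B * T ^ (-α) ≤ c * K * T ^ (-β) :=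
      calc x₀ / B * T ^ (-α) ≤ |x₀| / B * T ^ (-β) := by
            gcongr
            exact le_abs_self _
        _ ≤ _ := by gcongr
    have h7 : c * (K * T ^ (-β)) ≤ c * x T := by gcongr
    simp only [hp]
    linarith
  have hpc : ContinuousAt p T :=
    ((continuousAt_const.mul (Real.continuousAt_rpow_const _ _ (Or.inl hT0.ne'))).sub
      (continuousAt_const.mul (Real.continuousAt_rpow_const _ _ (Or.inl hT0.ne')))).sub
      (hG.continuousAt (Ici_mem_nhds hT0))
  have hfin := setIntegral_rpow_mul_pos hα hα1 hT0 (hpint T hT0) (hkp T hT0) hw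
    (nhdsWithin_le_nhds (hpc.eventually (lt_mem_nhds hpT)))
  rw [hval T hT0] at hfin
  linarith

/-- Solutions of a scalar dissipative ordinary differential equation decay exponentially. -/
lemma tendsto_zero_of_integral_eq {c x₀ : ℝ} {x g : ℝ → ℝ} (hc : 0 < c)
    (hg : ContinuousOn g (Ici 0)) (hxg : ∀ t, 0 ≤ t → x t = x₀ + ∫ s in (0:ℝ)..t, g s)
    (hdis : ∀ t, 0 ≤ t → x t * g t ≤ -c * x t ^ 2) :
    Filter.Tendsto x Filter.atTop (nhds 0) := by
  have hg' : Continuous (fun t => g (max 0 t)) :=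
    hg.comp_continuous (by fun_prop) fun t => le_max_left 0 t
  set X : ℝ → ℝ := fun t => x₀ + ∫ s in (0:ℝ)..t, g (max 0 s) with hX
  have hxX : ∀ t, 0 ≤ t → x t = X t := fun t ht => by
    rw [hxg t ht, hX]
    congr 1
    refine intervalIntegral.integral_congr fun s hs => ?_
    rw [uIcc_of_le ht] at hs
    simp only [max_eq_right hs.1]
  have hXd : ∀ t, HasDerivAt X (g (max 0 t)) t := fun t =>
    ((hg'.integral_hasStrictDerivAt 0 t).hasDerivAt).const_add x₀
  have hVd : ∀ t, HasDerivAt (fun t => X t ^ 2 * Real.exp (2 * c * t))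
      ((2 * X t * g (max 0 t) + 2 * c * X t ^ 2) * Real.exp (2 * c * t)) t := fun t => by
    have h1 : HasDerivAt (fun t => Real.exp (2 * c * t)) (Real.exp (2 * c * t) * (2 * c)) t := by
      simpa using ((hasDerivAt_id t).const_mul (2 * c)).exp
    refine (((hXd t).fun_pow 2).fun_mul h1).congr_deriv ?_
    push_cast
    ring
  have hanti : AntitoneOn (fun t => X t ^ 2 * Real.exp (2 * c * t)) (Ici 0) := by
    refine antitoneOn_of_deriv_nonpos (convex_Ici 0)
      (fun t _ => (hVd t).continuousAt.continuousWithinAt)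
      (fun t _ => (hVd t).differentiableAt.differentiableWithinAt) fun t ht => ?_
    rw [interior_Ici] at ht
    have ht0 : 0 ≤ t := le_of_lt ht
    rw [(hVd t).deriv, max_eq_right ht0, ← hxX t ht0]
    exact mul_nonpos_of_nonpos_of_nonneg (by linarith [hdis t ht0]) (Real.exp_pos _).le
  have hbound : ∀ t, 0 ≤ t → x t ^ 2 ≤ X 0 ^ 2 * Real.exp (-(2 * c * t)) := fun t ht => by
    have := hanti self_mem_Ici ht ht
    simp only [mul_zero, Real.exp_zero, mul_one] at this
    rw [hxX t ht, Real.exp_neg, ← div_eq_mul_inv, le_div_iff₀ (Real.exp_pos _)]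
    exact this
  have hlim : Filter.Tendsto (fun t => X 0 ^ 2 * Real.exp (-(2 * c * t)))
      Filter.atTop (nhds 0) := by
    simpa using (Real.tendsto_exp_neg_atTop_nhds_zero.comp
      (Filter.tendsto_id.const_mul_atTop (by positivity : 0 < 2 * c))).const_mul (X 0 ^ 2)
  have hsq : Filter.Tendsto (fun t => x t ^ 2) Filter.atTop (nhds 0) :=
    tendsto_of_tendsto_of_tendsto_of_le_of_le' tendsto_const_nhds hlim
      (Filter.Eventually.of_forall fun t => sq_nonneg _)
      ((Filter.eventually_ge_atTop 0).mono hbound)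
  have habs : Filter.Tendsto (fun t => |x t|) Filter.atTop (nhds 0) := by
    simpa [Real.sqrt_sq_eq_abs] using hsq.sqrt
  exact (tendsto_zero_iff_abs_tendsto_zero x).2 habs

lemma div_le_sSup_aHigh {f : ℝ → ℝ → ℝ} {L : ℝ → ℝ} (hLc : ContinuousOn L (Ici 0))
    (hLip : ∀ t ∈ Ici (0:ℝ), ∀ x y : ℝ, |f t x - f t y| ≤ L t * |x - y|)
    (hf0 : ∀ t ∈ Ici (0:ℝ), f t 0 = 0) (hsup : sSup (aHigh f '' Ici 0) < 0)
    {t y : ℝ} (ht : 0 ≤ t) (hy : y ≠ 0) : f t y / y ≤ sSup (aHigh f '' Ici 0) := by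
  have hbdd : BddAbove (aHigh f '' Ici 0) := by
    by_contra h
    rw [Real.sSup_of_not_bddAbove h] at hsup
    exact hsup.false
  refine le_trans ?_ (le_csSup hbdd ⟨t, ht, rfl⟩)
  obtain ⟨M, hM⟩ := (isCompact_Icc (a := (0:ℝ)) (b := t)).bddAbove_image
    (hLc.mono Icc_subset_Ici_self)
  refine le_csSup ⟨M, ?_⟩ ⟨t, ⟨ht, le_rfl⟩, y, hy, rfl⟩
  rintro _ ⟨s, hs, z, hz, rfl⟩
  refine le_trans ?_ (hM ⟨s, hs, rfl⟩)
  have h := hLip s hs.1 z 0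
  rw [hf0 s hs.1, sub_zero, sub_zero] at h
  refine (le_abs_self _).trans ?_
  rw [abs_div, div_le_iff₀ (abs_pos.2 hz)]
  exact h

/-- Asymptotic stability in the nonlinear case: if `f(t,0)=0` for all `t ≥ 0` and
`sup_{t ≥ 0} a^*(t) < 0`, then every solution of `^C D^α_{0+} x(t) = f(t,x(t))`
on `[0,∞)` tends to `0` at infinity. -/
theorem caputo_nonlinear_asymptotic_stability (α : ℝ) (hα : 0 < α) (hα1 : α ≤ 1)
    (f : ℝ → ℝ → ℝ)
    (hf : ContinuousOn (fun p : ℝ × ℝ => f p.1 p.2) (Set.Ici 0 ×ˢ Set.univ))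
    (L : ℝ → ℝ) (hLc : ContinuousOn L (Set.Ici 0))
    (hLnn : ∀ t ∈ Set.Ici (0:ℝ), 0 ≤ L t)
    (hLip : ∀ t ∈ Set.Ici (0:ℝ), ∀ x y : ℝ, |f t x - f t y| ≤ L t * |x - y|)
    (hf0 : ∀ t ∈ Set.Ici (0:ℝ), f t 0 = 0)
    (hsup : sSup (aHigh f '' Set.Ici 0) < 0) :
    ∀ (x₀ : ℝ) (x : ℝ → ℝ), IsCaputoSolutionIci α f x₀ x →
      Filter.Tendsto x Filter.atTop (nhds 0) := by
  rintro x₀ x ⟨hx, hsol⟩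
  obtain ⟨c, hc, hle⟩ : ∃ c > 0, ∀ t y : ℝ, 0 ≤ t → y ≠ 0 → f t y / y ≤ -c :=
    ⟨-sSup (aHigh f '' Ici 0), by linarith, fun t y ht hy => by
      rw [neg_neg]; exact div_le_sSup_aHigh hLc hLip hf0 hsup ht hy⟩
  have hpos : ∀ t y : ℝ, 0 ≤ t → 0 < y → f t y ≤ -c * y := fun t y ht hy =>
    (div_le_iff₀ hy).1 (hle t y ht hy.ne')
  have hneg : ∀ t y : ℝ, 0 ≤ t → y < 0 → -c * y ≤ f t y := fun t y ht hy =>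
    (div_le_iff_of_neg hy).1 (hle t y ht hy.ne)
  have hg : ContinuousOn (fun t => f t (x t)) (Ici 0) :=
    hf.comp (continuousOn_id.prodMk hx) fun t ht => ⟨ht, mem_univ _⟩
  rcases hα1.lt_or_eq with hα1 | rfl
  · set k := 1 / Real.Gamma α with hk
    have hk0 : 0 < k := one_div_pos.2 (Real.Gamma_pos_of_pos hα)
    have hvol : ∀ t, 0 ≤ t →
        x t = x₀ + ∫ s in Ioo 0 t, (t - s) ^ (α - 1) * (k * f s (x s)) := fun t ht => by
      rw [hsol t ht, intervalIntegral.integral_of_le ht, integral_Ioc_eq_integral_Ioo,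
        ← MeasureTheory.integral_const_mul]
      simp only [mul_left_comm]
    obtain ⟨β, hβ, K, hK⟩ := exists_le_rpow_of_volterra (c := k * c) (x₀ := x₀) hα hα1
      (by positivity) hx (hg.const_mul k) hvol fun t ht h => by
        have := mul_le_mul_of_nonneg_left (hpos t (x t) ht h) hk0.le
        linarith
    obtain ⟨β', hβ', K', hK'⟩ := exists_le_rpow_of_volterra (c := k * c) (x₀ := -x₀)
      (x := fun t => -x t) (G := fun s => -(k * f s (x s))) hα hα1
      (by positivity) hx.neg (hg.const_mul k).neg (fun t ht => by
        simp only [mul_neg, MeasureTheory.integral_neg]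
        rw [← neg_add, ← hvol t ht]) fun t ht h => by
        have := mul_le_mul_of_nonneg_left (hneg t (x t) ht (neg_pos.1 h)) hk0.le
        linarith
    have h1 := (tendsto_rpow_neg_atTop hβ).const_mul K
    have h2 := ((tendsto_rpow_neg_atTop hβ').const_mul K').neg
    simp only [mul_zero, neg_zero] at h1 h2
    refine tendsto_of_tendsto_of_tendsto_of_le_of_le' h2 h1
      ((Filter.eventually_ge_atTop 1).mono fun t ht => ?_)
      ((Filter.eventually_ge_atTop 1).mono hK)
    linarith [hK' t ht]
  · refine tendsto_zero_of_integral_eq (x₀ := x₀) hc hg (fun t ht => ?_) fun t ht => ?_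
    · simpa using hsol t ht
    · rcases lt_trichotomy (x t) 0 with h | h | h
      · nlinarith [hneg t (x t) ht h]
      · simp [h]
      · nlinarith [hpos t (x t) ht h]
end
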